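/- arXiv:1804.02339 — 9 statements merged into one kernel-verified Lean document; each statement's English description precedes it below -/
import Mathlib

section
/- Let f, g, h : ℝ^p → ℝ be convex with f differentiable, and let γ > 0. Define the operator T_γ : ℝ^p × ℝ^p → ℝ^p × ℝ^p by T_γ(z, u) = (z⁺, u⁺), where x = prox_{γg}(z − γ(u + ∇f(z))), z⁺ = prox_{γh}(x + γu), and u⁺ = u + (x − z⁺)/γ. Then T_γ(z, u) = (z, u) if and only if −u − ∇f(z) ∈ ∂g(z) and u ∈ ∂h(z). -/
open scoped RealInnerProductSpace

/-- `z` is the proximal point `prox_{γ φ}(x)`, i.e. `z` minimizes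
`y ↦ φ y + ‖x - y‖² / (2γ)` over `ℝ^p` (for convex `φ` and `γ > 0` this
minimizer is unique). -/
def IsProx {p : ℕ} (φ : EuclideanSpace ℝ (Fin p) → ℝ) (γ : ℝ)
    (x z : EuclideanSpace ℝ (Fin p)) : Prop :=
  ∀ y, φ z + ‖x - z‖ ^ 2 / (2 * γ) ≤ φ y + ‖x - y‖ ^ 2 / (2 * γ)

/-- `u` belongs to the subdifferential `∂φ(x)`. -/
def SubgradAt {p : ℕ} (φ : EuclideanSpace ℝ (Fin p) → ℝ)
    (x u : EuclideanSpace ℝ (Fin p)) : Prop :=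
  ∀ y, φ x + ⟪u, y - x⟫ ≤ φ y

theorem subgrad_of_isProx {p : ℕ} {φ : EuclideanSpace ℝ (Fin p) → ℝ} {γ : ℝ}
    {x z : EuclideanSpace ℝ (Fin p)} (hφ : ConvexOn ℝ Set.univ φ) (hγ : 0 < γ)
    (h : IsProx φ γ x z) : SubgradAt φ z (γ⁻¹ • (x - z)) := by
  intro y
  apply le_of_forall_pos_le_add
  intro ε hε
  set C : ℝ := ‖y - z‖ ^ 2 / (2 * γ) with hC
  have hC0 : 0 ≤ C := by positivity
  obtain ⟨t, ht0, ht1, htC⟩ : ∃ t : ℝ, 0 < t ∧ t ≤ 1 ∧ t * C ≤ ε := by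
    refine ⟨min 1 (ε / (C + 1)), by positivity, min_le_left _ _, ?_⟩
    have h1 : min 1 (ε / (C + 1)) * C ≤ ε / (C + 1) * C :=
      mul_le_mul_of_nonneg_right (min_le_right _ _) hC0
    have h2 : ε / (C + 1) * (C + 1) = ε := by field_simp
    have h3 : 0 < ε / (C + 1) := by positivity
    nlinarith
  have hc := hφ.2 (Set.mem_univ z) (Set.mem_univ y) (sub_nonneg.2 ht1) ht0.le (by ring)
  have hp := h ((1 - t) • z + t • y)
  have he : x - ((1 - t) • z + t • y) = (x - z) - t • (y - z) := by module
  rw [he, norm_sub_sq_real (x - z), inner_smul_right, norm_smul, Real.norm_of_nonneg ht0.le] at hp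
  have hsplit : (‖x - z‖ ^ 2 - 2 * (t * ⟪x - z, y - z⟫) + (t * ‖y - z‖) ^ 2) / (2 * γ)
      = ‖x - z‖ ^ 2 / (2 * γ) - t * (γ⁻¹ * ⟪x - z, y - z⟫) + t * (t * C) := by
    rw [hC]; field_simp
  rw [hsplit] at hp
  rw [real_inner_smul_left]
  simp only [smul_eq_mul] at hc
  have : t * (φ z + γ⁻¹ * ⟪x - z, y - z⟫) ≤ t * (φ y + t * C) := by nlinarith
  have := le_of_mul_le_mul_left this ht0
  linarith

theorem isProx_eq_of_subgrad {p : ℕ} {φ : EuclideanSpace ℝ (Fin p) → ℝ} {γ : ℝ}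
    {z v w : EuclideanSpace ℝ (Fin p)} (hφ : ConvexOn ℝ Set.univ φ) (hγ : 0 < γ)
    (hv : SubgradAt φ z v) (h : IsProx φ γ (z + γ • v) w) : w = z := by
  have h1 := subgrad_of_isProx hφ hγ h z
  have h2 := hv w
  have he : γ⁻¹ • (z + γ • v - w) = γ⁻¹ • (z - w) + v := by
    rw [add_sub_right_comm, smul_add, smul_smul, inv_mul_cancel₀ hγ.ne', one_smul]
  rw [he, inner_add_left, real_inner_smul_left, real_inner_self_eq_norm_sq] at h1
  rw [← neg_sub z w, inner_neg_right] at h2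
  have h3 : γ⁻¹ * ‖z - w‖ ^ 2 ≤ 0 := by linarith
  have h4 : ‖z - w‖ ^ 2 ≤ 0 := by
    by_contra hcon
    push Not at hcon
    have : 0 < γ⁻¹ * ‖z - w‖ ^ 2 := by positivity
    linarith
  have h5 : ‖z - w‖ = 0 := by nlinarith [norm_nonneg (z - w)]
  exact (sub_eq_zero.1 (norm_eq_zero.1 h5)).symm

/-- **Fixed points of the three operator splitting map: subdifferential
characterization.** With `x = prox_{γ g}(z - γ(u + ∇f(z)))`,
`z⁺ = prox_{γ h}(x + γ u)` and `u⁺ = u + (x - z⁺)/γ`, we have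
`T_γ(z, u) = (z, u)` iff `-u - ∇f(z) ∈ ∂g(z)` and `u ∈ ∂h(z)`. -/
theorem tos_fixed_point_iff_subgrad {p : ℕ}
    (f g h : EuclideanSpace ℝ (Fin p) → ℝ)
    (f' : EuclideanSpace ℝ (Fin p) → EuclideanSpace ℝ (Fin p))
    (hf : ConvexOn ℝ Set.univ f) (hg : ConvexOn ℝ Set.univ g)
    (hh : ConvexOn ℝ Set.univ h)
    (hf' : ∀ w, HasGradientAt f (f' w) w)
    (γ : ℝ) (hγ : 0 < γ)
    (z u x zp up : EuclideanSpace ℝ (Fin p))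
    (hx : IsProx g γ (z - γ • (u + f' z)) x)
    (hzp : IsProx h γ (x + γ • u) zp)
    (hup : up = u + γ⁻¹ • (x - zp)) :
    (zp = z ∧ up = u) ↔ (SubgradAt g z (-u - f' z) ∧ SubgradAt h z u) := by
  have e1 : z - γ • (u + f' z) = z + γ • (-u - f' z) := by module
  rw [e1] at hx
  constructor
  · rintro ⟨rfl, h2⟩
    have h3 : γ⁻¹ • (x - zp) = 0 := by
      rw [hup] at h2
      simpa using h2
    have h4 : x = zp := by
      rcases smul_eq_zero.1 h3 with h | h
      · exact absurd h (inv_ne_zero hγ.ne')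
      · exact sub_eq_zero.1 h
    subst h4
    have a := subgrad_of_isProx hg hγ hx
    have b := subgrad_of_isProx hh hγ hzp
    rw [add_sub_cancel_left, smul_smul, inv_mul_cancel₀ hγ.ne', one_smul] at a b
    exact ⟨a, b⟩
  · rintro ⟨a, b⟩
    have h1 := isProx_eq_of_subgrad hg hγ a hx
    subst h1
    have h2 := isProx_eq_of_subgrad hh hγ b hzp
    subst h2
    exact ⟨rfl, by simp [hup]⟩
end

section
/- Let f, g, h : ℝ^p → ℝ be convex with f differentiable, let γ > 0, and let T_γ(z, u) = (z⁺, u⁺) with x = prox_{γg}(z − γ(u + ∇f(z))), z⁺ = prox_{γh}(x + γu), u⁺ = u + (x − z⁺)/γ. If T_γ(z, u) = (z, u), then z minimizes the primal objective P(x) = f(x) + g(x) + h(x) over ℝ^p, and u minimizes the dual objective D(v) = (f+g)*(−v) + h*(v) (an ℝ ∪ {+∞}-valued function) over ℝ^p. -/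
open scoped RealInnerProductSpace

/-- The Fenchel conjugate `φ*(u) = sup_x (⟨x, u⟩ - φ(x))`, valued in `ℝ ∪ {+∞}`
(modelled by `EReal`; for real-valued `φ` the value is never `-∞`). -/
noncomputable def fenchel {p : ℕ} (φ : EuclideanSpace ℝ (Fin p) → ℝ)
    (u : EuclideanSpace ℝ (Fin p)) : EReal :=
  ⨆ x, ((⟪x, u⟫ - φ x : ℝ) : EReal)

/-- The proximal optimality condition yields a subgradient. -/
theorem prox_subgrad {p : ℕ} (φ : EuclideanSpace ℝ (Fin p) → ℝ)
    (hφ : ConvexOn ℝ Set.univ φ) (γ : ℝ) (hγ : 0 < γ)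
    (z s : EuclideanSpace ℝ (Fin p)) (hz : IsProx φ γ (z + γ • s) z)
    (y : EuclideanSpace ℝ (Fin p)) : φ z + ⟪s, y - z⟫ ≤ φ y := by
  by_contra! hlt
  set K : ℝ := ‖y - z‖ ^ 2 / (2 * γ) with hK
  have hK0 : 0 ≤ K := by positivity
  have key : ∀ t : ℝ, 0 < t → t ≤ 1 → 0 ≤ (φ y - φ z - ⟪s, y - z⟫) + t * K := by
    intro t ht ht1
    have h1 := hz (z + t • (y - z))
    have h2 : φ (z + t • (y - z)) ≤ (1 - t) * φ z + t * φ y := by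
      have := hφ.2 (Set.mem_univ z) (Set.mem_univ y) (sub_nonneg.2 ht1) ht.le (by ring)
      have e : z + t • (y - z) = (1 - t) • z + t • y := by module
      rw [e]
      simpa using this
    have e1 : z + γ • s - z = γ • s := by module
    have e2 : z + γ • s - (z + t • (y - z)) = γ • s - t • (y - z) := by module
    rw [e1, e2, norm_sub_sq_real, inner_smul_left, inner_smul_right, norm_smul t, mul_pow,
      Real.norm_eq_abs, sq_abs] at h1
    have e3 : (‖γ • s‖ ^ 2 - 2 * (γ * (t * ⟪s, y - z⟫)) + t ^ 2 * ‖y - z‖ ^ 2) / (2 * γ)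
        = ‖γ • s‖ ^ 2 / (2 * γ) - t * ⟪s, y - z⟫ + t ^ 2 * K := by
      rw [hK]; field_simp
    simp only [conj_trivial] at h1
    rw [e3] at h1
    have : 0 ≤ t * ((φ y - φ z - ⟪s, y - z⟫) + t * K) := by nlinarith
    exact nonneg_of_mul_nonneg_right this ht
  set A : ℝ := φ y - φ z - ⟪s, y - z⟫ with hA
  have hA0 : A < 0 := by linarith
  have hp : 0 < K - A := by linarith
  have h3 := key (-A / (2 * (K - A))) (by apply div_pos <;> linarith)
    (by rw [div_le_one (by linarith)]; linarith)
  have h4 : -A / (2 * (K - A)) * K ≤ -A / 2 := by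
    rw [div_mul_eq_mul_div, div_le_div_iff₀ (by linarith) (by norm_num)]
    nlinarith
  linarith

/-- The gradient inequality for a convex differentiable function. -/
theorem grad_subgrad {p : ℕ} (f : EuclideanSpace ℝ (Fin p) → ℝ)
    (hf : ConvexOn ℝ Set.univ f) (z f' : EuclideanSpace ℝ (Fin p))
    (hf' : HasGradientAt f f' z)
    (y : EuclideanSpace ℝ (Fin p)) : f z + ⟪f', y - z⟫ ≤ f y := by
  have hc : ConvexOn ℝ Set.univ (f ∘ (AffineMap.lineMap z y : ℝ →ᵃ[ℝ] _)) := by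
    simpa using hf.comp_affineMap (AffineMap.lineMap z y : ℝ →ᵃ[ℝ] _)
  have hd : HasDerivAt (f ∘ (AffineMap.lineMap z y : ℝ →ᵃ[ℝ] _)) ⟪f', y - z⟫ 0 := by
    have h1 : HasDerivAt (AffineMap.lineMap z y : ℝ →ᵃ[ℝ] _) (y - z) (0 : ℝ) :=
      AffineMap.hasDerivAt_lineMap
    have h2 := hf'.hasFDerivAt
    rw [← AffineMap.lineMap_apply_zero (k := ℝ) z y] at h2
    simpa using h2.comp_hasDerivAt (0 : ℝ) h1
  have := hc.le_slope_of_hasDerivAt (Set.mem_univ 0) (Set.mem_univ 1) one_pos hd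
  simp [slope_def_field] at this
  linarith

/-- Upper bound for the conjugate at a subgradient. -/
theorem fenchel_le_of_subgrad {p : ℕ} (φ : EuclideanSpace ℝ (Fin p) → ℝ)
    (z s : EuclideanSpace ℝ (Fin p)) (hs : ∀ y, φ z + ⟪s, y - z⟫ ≤ φ y) :
    fenchel φ s ≤ ((⟪z, s⟫ - φ z : ℝ) : EReal) := by
  refine iSup_le fun y => EReal.coe_le_coe_iff.2 ?_
  have := hs y
  rw [inner_sub_right, real_inner_comm, real_inner_comm z s] at this
  linarith

/-- The Fenchel-Young inequality. -/
theorem le_fenchel {p : ℕ} (φ : EuclideanSpace ℝ (Fin p) → ℝ)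
    (z s : EuclideanSpace ℝ (Fin p)) :
    ((⟪z, s⟫ - φ z : ℝ) : EReal) ≤ fenchel φ s :=
  le_iSup (fun x => ((⟪x, s⟫ - φ x : ℝ) : EReal)) z

/-- **Fixed points of the three operator splitting map are primal-dual
solutions.** If `T_γ(z, u) = (z, u)`, then `z` minimizes the primal objective
`P = f + g + h` and `u` minimizes the dual objective
`D(v) = (f+g)*(-v) + h*(v)`. -/
theorem tos_fixed_point_is_primal_dual_solution {p : ℕ}
    (f g h : EuclideanSpace ℝ (Fin p) → ℝ)
    (f' : EuclideanSpace ℝ (Fin p) → EuclideanSpace ℝ (Fin p))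
    (hf : ConvexOn ℝ Set.univ f) (hg : ConvexOn ℝ Set.univ g)
    (hh : ConvexOn ℝ Set.univ h)
    (hf' : ∀ w, HasGradientAt f (f' w) w)
    (γ : ℝ) (hγ : 0 < γ)
    (z u x zp up : EuclideanSpace ℝ (Fin p))
    (hx : IsProx g γ (z - γ • (u + f' z)) x)
    (hzp : IsProx h γ (x + γ • u) zp)
    (hup : up = u + γ⁻¹ • (x - zp))
    (hfix : zp = z ∧ up = u) :
    (∀ y, f z + g z + h z ≤ f y + g y + h y) ∧
      (∀ v, fenchel (fun w => f w + g w) (-u) + fenchel h u ≤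
        fenchel (fun w => f w + g w) (-v) + fenchel h v) := by
  obtain ⟨rfl, rfl⟩ := hfix
  have hxz : x = zp := by
    have h0 : γ⁻¹ • (x - zp) = 0 := by simpa using hup
    rcases smul_eq_zero.1 h0 with h1 | h1
    · exact absurd h1 (inv_ne_zero hγ.ne')
    · exact sub_eq_zero.1 h1
  subst hxz
  have sh := prox_subgrad h hh γ hγ x up hzp
  have sg := prox_subgrad g hg γ hγ x (-(up + f' x)) (by
    have e : x + γ • (-(up + f' x)) = x - γ • (up + f' x) := by module
    rw [e]; exact hx)
  have sf := grad_subgrad f hf x (f' x) (hf' x)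
  have sF : ∀ y, f x + g x + ⟪-up, y - x⟫ ≤ f y + g y := by
    intro y
    have h1 := sg y
    have h2 := sf y
    rw [inner_neg_left, inner_add_left] at h1
    rw [inner_neg_left]
    linarith
  constructor
  · intro y
    have h1 := sF y
    have h2 := sh y
    rw [inner_neg_left] at h1
    linarith
  · intro v
    refine (add_le_add (fenchel_le_of_subgrad (fun w => f w + g w) x (-up) sF)
      (fenchel_le_of_subgrad h x up sh)).trans ?_
    refine le_trans (le_of_eq ?_) (add_le_add (le_fenchel (fun w => f w + g w) x (-v))
      (le_fenchel h x v))
    rw [← EReal.coe_add, ← EReal.coe_add, inner_neg_right, inner_neg_right]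
    congr 1
    ring
end

section
/- Let f, g, h : ℝ^p → ℝ be convex with f differentiable, let γ > 0, and let T_γ(z, u) = (z⁺, u⁺) with x = prox_{γg}(z − γ(u + ∇f(z))), z⁺ = prox_{γh}(x + γu), u⁺ = u + (x − z⁺)/γ. If z minimizes the primal objective P(x) = f(x) + g(x) + h(x) over ℝ^p and u minimizes the dual objective D(v) = (f+g)*(−v) + h*(v) over ℝ^p, then T_γ(z, u) = (z, u). Hence the fixed-point set of T_γ equals (argmin P) × (argmin D). -/
open scoped RealInnerProductSpace

/-- The dual objective `D(v) = (f+g)*(-v) + h*(v)`. -/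
noncomputable def dualObj {p : ℕ} (f g h : EuclideanSpace ℝ (Fin p) → ℝ)
    (v : EuclideanSpace ℝ (Fin p)) : EReal :=
  fenchel (fun w => f w + g w) (-v) + fenchel h v

theorem aux_small {a b : ℝ} (H : ∀ t : ℝ, 0 < t → t < 1 → 0 ≤ a + t * b) : 0 ≤ a := by
  have h1 : Filter.Tendsto (fun t : ℝ => a + t * b) (nhdsWithin 0 (Set.Ioi 0)) (nhds (a + 0 * b)) := by
    apply Filter.Tendsto.mono_left _ nhdsWithin_le_nhds
    exact (Continuous.tendsto (by fun_prop) 0)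
  have h2 : 0 ≤ a + 0 * b := by
    refine ge_of_tendsto h1 ?_
    filter_upwards [Ioo_mem_nhdsGT (zero_lt_one (α := ℝ))] with t ht
    exact H t ht.1 ht.2
  simpa using h2

theorem aux_seg {p : ℕ} {φ : EuclideanSpace ℝ (Fin p) → ℝ} (hφ : ConvexOn ℝ Set.univ φ)
    (z d : EuclideanSpace ℝ (Fin p)) (t : ℝ) (h0 : 0 < t) (h1 : t < 1) :
    φ (z + t • d) ≤ φ z + t * (φ (z + d) - φ z) := by
  have := hφ.2 (Set.mem_univ z) (Set.mem_univ (z + d)) (sub_nonneg.2 h1.le) h0.le (by ring)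
  have e : (1 - t) • z + t • (z + d) = z + t • d := by module
  rw [e] at this
  simp only [smul_eq_mul] at this
  linarith

theorem aux_slope {p : ℕ} {f : EuclideanSpace ℝ (Fin p) → ℝ} {v z : EuclideanSpace ℝ (Fin p)}
    (hf : HasGradientAt f v z) (d : EuclideanSpace ℝ (Fin p)) :
    Filter.Tendsto (fun t : ℝ => t⁻¹ * (f (z + t • d) - f z)) (nhdsWithin 0 (Set.Ioi 0))
      (nhds ⟪v, d⟫) := by
  have h1 : HasDerivAt (fun t : ℝ => f (z + t • d)) ⟪v, d⟫ 0 := by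
    have h2 : HasDerivAt (fun t : ℝ => z + t • d) d 0 := by
      simpa using ((hasDerivAt_id (0 : ℝ)).smul_const d).const_add z
    have h3 : HasFDerivAt f (InnerProductSpace.toDual ℝ _ v) (z + (0 : ℝ) • d) := by
      simpa using hf.hasFDerivAt
    have h4 := h3.comp_hasDerivAt (0 : ℝ) h2
    rw [InnerProductSpace.toDual_apply_apply] at h4
    exact h4
  have := h1.tendsto_slope_zero_right
  simpa using this

theorem aux_upper {p : ℕ} {f : EuclideanSpace ℝ (Fin p) → ℝ} {v z : EuclideanSpace ℝ (Fin p)}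
    (hf : HasGradientAt f v z) (d : EuclideanSpace ℝ (Fin p)) (c : ℝ)
    (H : ∀ t : ℝ, 0 < t → t < 1 → f (z + t • d) - f z ≤ t * c) : ⟪v, d⟫ ≤ c := by
  refine le_of_tendsto (aux_slope hf d) ?_
  filter_upwards [Ioo_mem_nhdsGT (zero_lt_one (α := ℝ))] with t ht
  rw [inv_mul_le_iff₀ ht.1]
  exact H t ht.1 ht.2

theorem aux_lower {p : ℕ} {f : EuclideanSpace ℝ (Fin p) → ℝ} {v z : EuclideanSpace ℝ (Fin p)}
    (hf : HasGradientAt f v z) (d : EuclideanSpace ℝ (Fin p)) (c : ℝ)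
    (H : ∀ t : ℝ, 0 < t → t < 1 → t * c ≤ f (z + t • d) - f z) : c ≤ ⟪v, d⟫ := by
  refine ge_of_tendsto (aux_slope hf d) ?_
  filter_upwards [Ioo_mem_nhdsGT (zero_lt_one (α := ℝ))] with t ht
  rw [le_inv_mul_iff₀ ht.1]
  exact H t ht.1 ht.2

/-- Subgradient relation. -/
def IsSubg {p : ℕ} (φ : EuclideanSpace ℝ (Fin p) → ℝ) (v z : EuclideanSpace ℝ (Fin p)) : Prop :=
  ∀ d, φ z + ⟪v, d⟫ ≤ φ (z + d)

theorem aux_prox {p : ℕ} {φ : EuclideanSpace ℝ (Fin p) → ℝ} (hφ : ConvexOn ℝ Set.univ φ)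
    {γ : ℝ} (hγ : 0 < γ) (z v : EuclideanSpace ℝ (Fin p)) :
    IsProx φ γ (z + γ • v) z ↔ IsSubg φ v z := by
  have key : ∀ d : EuclideanSpace ℝ (Fin p),
      ‖z + γ • v - (z + d)‖ ^ 2 / (2 * γ) =
        ‖z + γ • v - z‖ ^ 2 / (2 * γ) - ⟪v, d⟫ + ‖d‖ ^ 2 / (2 * γ) := by
    intro d
    have e1 : z + γ • v - (z + d) = γ • v - d := by abel
    have e2 : z + γ • v - z = γ • v := by abel
    rw [e1, e2, norm_sub_sq_real, real_inner_smul_left]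
    field_simp
  constructor
  · intro H d
    have : 0 ≤ (φ (z + d) - φ z - ⟪v, d⟫) := by
      apply aux_small (b := ‖d‖ ^ 2 / (2 * γ))
      intro t h0 h1
      have a1 := H (z + t • d)
      rw [key, norm_smul, real_inner_smul_right, mul_pow, Real.norm_eq_abs, sq_abs] at a1
      have a2 := aux_seg hφ z d t h0 h1
      have a3 : 0 ≤ t * (φ (z + d) - φ z - ⟪v, d⟫ + t * (‖d‖ ^ 2 / (2 * γ))) := by
        have : t ^ 2 * ‖d‖ ^ 2 / (2 * γ) = t * (t * (‖d‖ ^ 2 / (2 * γ))) := by ring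
        rw [this] at a1
        linarith
      exact nonneg_of_mul_nonneg_right a3 h0
    linarith
  · intro H y
    have e : y = z + (y - z) := by abel
    rw [e, key]
    have := H (y - z)
    have : 0 ≤ ‖y - z‖ ^ 2 / (2 * γ) := by positivity
    linarith

theorem aux_prox_unique {p : ℕ} {φ : EuclideanSpace ℝ (Fin p) → ℝ} (hφ : ConvexOn ℝ Set.univ φ)
    {γ : ℝ} (hγ : 0 < γ) {w a b : EuclideanSpace ℝ (Fin p)}
    (ha : IsProx φ γ w a) (hb : IsProx φ γ w b) : a = b := by
  have e : ∀ c : EuclideanSpace ℝ (Fin p), w = c + γ • (γ⁻¹ • (w - c)) := by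
    intro c
    rw [smul_smul, mul_inv_cancel₀ hγ.ne', one_smul]; abel
  rw [e a, aux_prox hφ hγ] at ha
  rw [e b, aux_prox hφ hγ] at hb
  have h1 := ha (b - a)
  have h2 := hb (a - b)
  rw [add_sub_cancel, real_inner_smul_left] at h1 h2
  have h3 : γ⁻¹ * ⟪w - a, b - a⟫ + γ⁻¹ * ⟪w - b, a - b⟫ = γ⁻¹ * ‖a - b‖ ^ 2 := by
    rw [← real_inner_self_eq_norm_sq]
    simp only [inner_sub_left, inner_sub_right]
    ring
  have h4 : γ⁻¹ * ‖a - b‖ ^ 2 ≤ 0 := by linarith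
  have h5 : ‖a - b‖ ^ 2 ≤ 0 := by
    by_contra hc
    push Not at hc
    have := mul_pos (inv_pos.2 hγ) hc
    linarith
  have h6 : ‖a - b‖ = 0 := by
    have := sq_nonneg ‖a - b‖
    exact pow_eq_zero_iff (two_ne_zero) |>.1 (le_antisymm h5 this)
  exact sub_eq_zero.1 (norm_eq_zero.1 h6)

theorem aux_sum {p : ℕ} {f g : EuclideanSpace ℝ (Fin p) → ℝ} (hf : ConvexOn ℝ Set.univ f)
    (hg : ConvexOn ℝ Set.univ g) {v z : EuclideanSpace ℝ (Fin p)} (hf' : HasGradientAt f v z)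
    (u : EuclideanSpace ℝ (Fin p)) :
    IsSubg g (-(u + v)) z ↔ IsSubg (fun w => f w + g w) (-u) z := by
  constructor
  · intro H d
    have h1 := H d
    have h2 : ⟪v, d⟫ ≤ f (z + d) - f z := by
      apply aux_upper hf'
      intro t h0 h1
      have := aux_seg hf z d t h0 h1
      linarith
    simp only [inner_neg_left, inner_add_left] at h1 ⊢
    linarith
  · intro H d
    have : -⟪u, d⟫ - (g (z + d) - g z) ≤ ⟪v, d⟫ := by
      apply aux_lower hf'
      intro t h0 h1
      have h2 := aux_seg hg z d t h0 h1
      have h3 := H (t • d)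
      simp only [inner_neg_left, real_inner_smul_right] at h3
      linarith
    simp only [inner_neg_left, inner_add_left]
    linarith

theorem aux_duality {p : ℕ} {F h : EuclideanSpace ℝ (Fin p) → ℝ} (hF : ConvexOn ℝ Set.univ F)
    (hh : ConvexOn ℝ Set.univ h) {z : EuclideanSpace ℝ (Fin p)}
    (hz : ∀ y, F z + h z ≤ F y + h y) : ∃ v, IsSubg F (-v) z ∧ IsSubg h v z := by
  have hc : Continuous F := by
    rw [← continuousOn_univ]
    exact hF.continuousOn isOpen_univ
  have cA : Convex ℝ {q : EuclideanSpace ℝ (Fin p) × ℝ | F q.1 - F z < q.2} := by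
    have := (hF.sub (concaveOn_const (F z) convex_univ)).convex_strict_epigraph
    simpa using this
  have oA : IsOpen {q : EuclideanSpace ℝ (Fin p) × ℝ | F q.1 - F z < q.2} :=
    isOpen_lt (by fun_prop) (by fun_prop)
  have cB : Convex ℝ {q : EuclideanSpace ℝ (Fin p) × ℝ | q.2 ≤ h z - h q.1} := by
    have := ((concaveOn_const (h z) convex_univ).sub hh).convex_hypograph
    simpa using this
  obtain ⟨L, s, hA, hB⟩ := geometric_hahn_banach_open cA oA cB (by
    rw [Set.disjoint_left]
    intro q h1 h2
    simp only [Set.mem_ofPred_eq] at h1 h2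
    have := hz q.1
    linarith)
  obtain ⟨l, hl⟩ : ∃ l : EuclideanSpace ℝ (Fin p), ∀ x, L (x, 0) = ⟪l, x⟫ :=
    ⟨(InnerProductSpace.toDual ℝ _).symm (L.comp (ContinuousLinearMap.inl ℝ _ ℝ)), fun x => by simp⟩
  have hL : ∀ x t, L (x, t) = ⟪l, x⟫ + t * L (0, 1) := by
    intro x t
    rw [← hl, ← smul_eq_mul, ← map_smul, ← map_add]
    simp
  set c := L (0, 1) with hcdef
  have A : ∀ x t, F x - F z < t → ⟪l, x⟫ + t * c < s := fun x t ht => by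
    rw [← hL]; exact hA (x, t) ht
  have B : ∀ x t, t ≤ h z - h x → s ≤ ⟪l, x⟫ + t * c := fun x t ht => by
    rw [← hL]; exact hB (x, t) ht
  have b0 := B z 0 (by simp)
  have a1 := A z 1 (by simp)
  have hcneg : c < 0 := by linarith
  have A' : ∀ x, ⟪l, x⟫ + (F x - F z) * c ≤ s := by
    intro x
    have : 0 ≤ s - (⟪l, x⟫ + (F x - F z) * c) := by
      apply aux_small (b := -c)
      intro t h0 h1
      have := A x (F x - F z + t) (by linarith)
      nlinarith
    linarith
  have a0 := A' z
  have hs : s = ⟪l, z⟫ := by simp at a0 b0; linarith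
  have hcc : c⁻¹ * c = 1 := inv_mul_cancel₀ hcneg.ne
  have hci : c⁻¹ < 0 := inv_lt_zero.2 hcneg
  refine ⟨c⁻¹ • l, fun d => ?_, fun d => ?_⟩
  · have h1 := A' (z + d)
    rw [inner_add_right, hs] at h1
    rw [inner_neg_left, real_inner_smul_left]
    have h2 : c⁻¹ * 0 ≤ c⁻¹ * (⟪l, d⟫ + (F (z + d) - F z) * c) :=
      mul_le_mul_of_nonpos_left (by linarith) hci.le
    have h3 : c⁻¹ * (⟪l, d⟫ + (F (z + d) - F z) * c) = c⁻¹ * ⟪l, d⟫ + (F (z + d) - F z) * (c⁻¹ * c) := by ring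
    rw [h3, hcc] at h2
    linarith
  · have h1 := B (z + d) _ le_rfl
    rw [inner_add_right, hs] at h1
    rw [real_inner_smul_left]
    have h2 : c⁻¹ * (⟪l, d⟫ + (h z - h (z + d)) * c) ≤ c⁻¹ * 0 :=
      mul_le_mul_of_nonpos_left (by linarith) hci.le
    have h3 : c⁻¹ * (⟪l, d⟫ + (h z - h (z + d)) * c) = c⁻¹ * ⟪l, d⟫ + (h z - h (z + d)) * (c⁻¹ * c) := by ring
    rw [h3, hcc] at h2
    linarith

theorem aux_dual_ge {p : ℕ} (f g h : EuclideanSpace ℝ (Fin p) → ℝ)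
    (v x y : EuclideanSpace ℝ (Fin p)) :
    (((⟪x, -v⟫ - (f x + g x)) + (⟪y, v⟫ - h y) : ℝ) : EReal) ≤ dualObj f g h v := by
  rw [EReal.coe_add]
  exact add_le_add
    (le_iSup (fun x => ((⟪x, -v⟫ - (f x + g x) : ℝ) : EReal)) x)
    (le_iSup (fun x => ((⟪x, v⟫ - h x : ℝ) : EReal)) y)

theorem aux_dual_le {p : ℕ} {f g h : EuclideanSpace ℝ (Fin p) → ℝ}
    {v z : EuclideanSpace ℝ (Fin p)} (h1 : IsSubg (fun w => f w + g w) (-v) z)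
    (h2 : IsSubg h v z) :
    dualObj f g h v ≤ ((-(f z + g z + h z) : ℝ) : EReal) := by
  have e : -(f z + g z + h z) = (⟪z, -v⟫ - (f z + g z)) + (⟪z, v⟫ - h z) := by
    rw [inner_neg_right]; ring
  rw [e, EReal.coe_add]
  refine add_le_add (iSup_le fun x => ?_) (iSup_le fun x => ?_)
  · rw [EReal.coe_le_coe_iff]
    have := h1 (x - z)
    simp only [add_sub_cancel] at this
    rw [inner_sub_right, real_inner_comm, real_inner_comm z] at this
    linarith
  · rw [EReal.coe_le_coe_iff]
    have := h2 (x - z)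
    rw [add_sub_cancel, inner_sub_right, real_inner_comm, real_inner_comm z] at this
    linarith

theorem aux_main {p : ℕ} {f g h : EuclideanSpace ℝ (Fin p) → ℝ}
    (hf : ConvexOn ℝ Set.univ f) (hg : ConvexOn ℝ Set.univ g)
    (hh : ConvexOn ℝ Set.univ h) (z u : EuclideanSpace ℝ (Fin p)) :
    (IsSubg (fun w => f w + g w) (-u) z ∧ IsSubg h u z) ↔
    ((∀ y, f z + g z + h z ≤ f y + g y + h y) ∧ ∀ v, dualObj f g h u ≤ dualObj f g h v) := by
  constructor
  · rintro ⟨h1, h2⟩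
    constructor
    · intro y
      have a := h1 (y - z)
      have b := h2 (y - z)
      simp only [add_sub_cancel, inner_neg_left] at a b
      linarith
    · intro v
      refine (aux_dual_le h1 h2).trans (le_trans (le_of_eq ?_) (aux_dual_ge f g h v z z))
      congr 1
      rw [inner_neg_right]; ring
  · rintro ⟨h1, h2⟩
    obtain ⟨v, v1, v2⟩ := aux_duality (hf.add hg) hh (z := z) h1
    have key : ∀ x y, (⟪x, -u⟫ - (f x + g x)) + (⟪y, u⟫ - h y) ≤ -(f z + g z + h z) := by
      intro x y
      rw [← EReal.coe_le_coe_iff]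
      exact (aux_dual_ge f g h u x y).trans ((h2 v).trans (aux_dual_le v1 v2))
    constructor
    · intro d
      have := key (z + d) z
      simp only [inner_add_left, inner_neg_right, inner_neg_left] at this ⊢
      rw [real_inner_comm u d] at *
      linarith
    · intro d
      have := key z (z + d)
      simp only [inner_add_left, inner_neg_right] at this
      rw [real_inner_comm u d] at *
      linarith

/-- **Primal-dual solutions are fixed points of the three operator splitting
map; the fixed-point set is `argmin P × argmin D`.** If `z` minimizes the
primal objective `P = f + g + h` and `u` minimizes the dual objective
`D(v) = (f+g)*(-v) + h*(v)`, then `T_γ(z, u) = (z, u)`; moreover the set of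
fixed points of `T_γ` equals `(argmin P) × (argmin D)`. -/
theorem primal_dual_solution_is_tos_fixed_point {p : ℕ}
    (f g h : EuclideanSpace ℝ (Fin p) → ℝ)
    (f' : EuclideanSpace ℝ (Fin p) → EuclideanSpace ℝ (Fin p))
    (hf : ConvexOn ℝ Set.univ f) (hg : ConvexOn ℝ Set.univ g)
    (hh : ConvexOn ℝ Set.univ h)
    (hf' : ∀ w, HasGradientAt f (f' w) w)
    (γ : ℝ) (hγ : 0 < γ)
    (z u x zp up : EuclideanSpace ℝ (Fin p))
    (hx : IsProx g γ (z - γ • (u + f' z)) x)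
    (hzp : IsProx h γ (x + γ • u) zp)
    (hup : up = u + γ⁻¹ • (x - zp))
    (hzmin : ∀ y, f z + g z + h z ≤ f y + g y + h y)
    (humin : ∀ v, dualObj f g h u ≤ dualObj f g h v) :
    (zp = z ∧ up = u) ∧
      {zu : EuclideanSpace ℝ (Fin p) × EuclideanSpace ℝ (Fin p) |
          ∃ x' zp' up', IsProx g γ (zu.1 - γ • (zu.2 + f' zu.1)) x' ∧
            IsProx h γ (x' + γ • zu.2) zp' ∧
            up' = zu.2 + γ⁻¹ • (x' - zp') ∧ zp' = zu.1 ∧ up' = zu.2} =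
        {w : EuclideanSpace ℝ (Fin p) |
            ∀ y, f w + g w + h w ≤ f y + g y + h y} ×ˢ
          {v : EuclideanSpace ℝ (Fin p) |
            ∀ v', dualObj f g h v ≤ dualObj f g h v'} := by
  have hiff : ∀ a b : EuclideanSpace ℝ (Fin p),
      (IsProx g γ (a - γ • (b + f' a)) a ∧ IsProx h γ (a + γ • b) a) ↔
      ((∀ y, f a + g a + h a ≤ f y + g y + h y) ∧
        ∀ v, dualObj f g h b ≤ dualObj f g h v) := by
    intro a b
    rw [← aux_main hf hg hh, ← aux_sum hf hg (hf' a), aux_prox hh hγ, sub_eq_add_neg, ← smul_neg,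
      aux_prox hg hγ]
  constructor
  · obtain ⟨h1, h2⟩ := (hiff z u).2 ⟨hzmin, humin⟩
    have e1 := aux_prox_unique hg hγ hx h1
    subst e1
    have e2 := aux_prox_unique hh hγ hzp h2
    subst e2
    exact ⟨rfl, by simpa using hup⟩
  · ext ⟨a, b⟩
    simp only [Set.mem_ofPred_eq, Set.mem_prod]
    rw [← hiff]
    constructor
    · rintro ⟨x', zp', up', h1, h2, h3, h4, h5⟩
      subst h4
      rw [h5] at h3
      have h6 : x' = zp' := by
        have : γ⁻¹ • (x' - zp') = 0 := by simpa using h3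
        rcases smul_eq_zero.1 this with h | h
        · exact absurd h (inv_ne_zero hγ.ne')
        · exact sub_eq_zero.1 h
      subst h6
      exact ⟨h1, h2⟩
    · rintro ⟨h1, h2⟩
      exact ⟨a, a, b, h1, h2, by simp, rfl, rfl⟩
end

section
/- (Key recursive inequality, Variant 2.) Let f, g, h : ℝ^p → ℝ be convex, with f differentiable, L_f-smooth and μ_f-strongly convex for some μ_f ≥ 0, suppose h* − (μ_h/2)‖·‖² is convex for some μ_h ≥ 0, and suppose h is β_h-Lipschitz with β_h > 0 and ‖u_0‖ ≤ β_h. Let τ ∈ (0,1), γ_0 > 0, and let (γ_t), (x_t), (z_t), (u_t) be adaptive three-operator-splitting iterates with δ_t ≥ 0, γ_t ≥ min{γ_0, τ/L_f}, and γ_t μ_f ≤ 1 for all t ≥ 0, and such that for every t ≥ 1 either γ_t ≤ γ_{t−1} or γ_t² ≤ γ_{t−1}² + γ_{t−1} δ_{t−1}/(4β_h²). Set ρ := μ_f · min{γ_0, τ/L_f} and L(x,u) := f(x) + g(x) + ⟨x,u⟩ − h*(u). Then for every t ≥ 0 and every x, u ∈ ℝ^p with h*(u) < +∞: 2γ_t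 (L(x_{t+1}, u) − L(x, u_{t+1})) + ‖z_{t+1} − x‖² + (1 + μ_f μ_h) γ_t² ‖u_{t+1} − u‖² ≤ (1 − ρ)‖z_t − x‖² + γ_{t−1}² ‖u_t − u‖² + γ_{t−1} δ_{t−1} − 2γ_t δ_t. -/
open scoped RealInnerProductSpace

/-- The saddle-point Lagrangian `L(x, u) = f(x) + g(x) + ⟨x, u⟩ - h*(u)`
(its real value, meaningful whenever `h*(u) < +∞`). -/
noncomputable def saddleL {p : ℕ} (f g h : EuclideanSpace ℝ (Fin p) → ℝ)
    (x u : EuclideanSpace ℝ (Fin p)) : ℝ :=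
  f x + g x + ⟪x, u⟫ - (fenchel h u).toReal

abbrev EV (p : ℕ) := EuclideanSpace ℝ (Fin p)

lemma aux_limit {A B : ℝ} (H : ∀ s : ℝ, 0 < s → s < 1 → A ≤ s * B) : A ≤ 0 := by
  by_contra hA
  push Not at hA
  have hB : 0 < |B| + A := by positivity
  have hs : 0 < A / (2 * (|B| + A)) := by positivity
  have h1 : A / (2 * (|B| + A)) < 1 := by
    rw [div_lt_one (by positivity)]; nlinarith [abs_nonneg B]
  have := H _ hs h1
  rw [div_mul_eq_mul_div, le_div_iff₀ (by positivity)] at this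
  nlinarith [le_abs_self B, abs_nonneg B]

lemma aux_norm_smul {p : ℕ} (a d : EV p) (s : ℝ) :
    ‖a + s • d‖ ^ 2 = ‖a‖ ^ 2 + 2 * s * ⟪a, d⟫ + s ^ 2 * ‖d‖ ^ 2 := by
  rw [norm_add_sq_real, inner_smul_right, norm_smul, mul_pow, Real.norm_eq_abs, sq_abs]; ring

lemma aux_prox_s4 {p : ℕ} {φ : EV p → ℝ} (hφ : ConvexOn ℝ Set.univ φ) {γ : ℝ} (hγ : 0 < γ)
    {w z : EV p} (hz : IsProx φ γ w z) (y : EV p) :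
    γ * φ z + ⟪w - z, y - z⟫ ≤ γ * φ y := by
  have key : γ * φ z + ⟪w - z, y - z⟫ - γ * φ y ≤ 0 := by
    apply aux_limit (B := ‖y - z‖ ^ 2 / 2)
    intro s hs hs1
    have h1 := hz (z + s • (y - z))
    have h2 := hφ.2 (Set.mem_univ z) (Set.mem_univ y) (by linarith : 0 ≤ 1 - s) hs.le (by ring)
    have e : (1 - s) • z + s • y = z + s • (y - z) := by module
    rw [e] at h2
    simp only [smul_eq_mul] at h2
    have e2 : w - (z + s • (y - z)) = (w - z) + (-s) • (y - z) := by module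
    rw [e2, aux_norm_smul] at h1
    have h3 : γ * φ z + ‖w - z‖ ^ 2 / 2 ≤ γ * φ (z + s • (y - z)) +
        (‖w - z‖ ^ 2 + 2 * -s * ⟪w - z, y - z⟫ + (-s) ^ 2 * ‖y - z‖ ^ 2) / 2 := by
      have := mul_le_mul_of_nonneg_left h1 hγ.le
      have a1 : ∀ q r : ℝ, γ * (q + r / (2 * γ)) = γ * q + r / 2 := by
        intro q r; field_simp
      rwa [a1, a1] at this
    have h4 := mul_le_mul_of_nonneg_left h2 hγ.le
    have : s * (γ * φ z + ⟪w - z, y - z⟫ - γ * φ y) ≤ s * (s * (‖y - z‖ ^ 2 / 2)) := by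
      linarith
    exact le_of_mul_le_mul_left this hs
  linarith

lemma aux_grad {p : ℕ} {f : EV p → ℝ} {f' : EV p} {μ : ℝ} {z : EV p}
    (hf' : HasGradientAt f f' z)
    (hc : ConvexOn ℝ Set.univ (fun w => f w - μ / 2 * ‖w‖ ^ 2)) (y : EV p) :
    f z + ⟪f', y - z⟫ + μ / 2 * ‖y - z‖ ^ 2 ≤ f y := by
  have hk := hc.comp_affineMap (AffineMap.lineMap z y)
  have hfun : ((fun w => f w - μ / 2 * ‖w‖ ^ 2) ∘ (AffineMap.lineMap z y : ℝ →ᵃ[ℝ] EV p)) =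
      fun s : ℝ => f (z + s • (y - z)) - μ / 2 * (‖z‖ ^ 2 + 2 * s * ⟪z, y - z⟫ + s ^ 2 * ‖y - z‖ ^ 2) := by
    funext s
    simp only [Function.comp, AffineMap.lineMap_apply, vsub_eq_sub, vadd_eq_add]
    rw [add_comm (s • (y - z)) z, aux_norm_smul]
  rw [hfun] at hk
  have hline : HasDerivAt (fun s : ℝ => z + s • (y - z)) (y - z) 0 := by
    simpa using ((hasDerivAt_id (0:ℝ)).smul_const (y - z)).const_add z
  have hf0 : HasFDerivAt f (InnerProductSpace.toDual ℝ _ f') (z + (0:ℝ) • (y - z)) := by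
    simpa using hf'.hasFDerivAt
  have hd1 : HasDerivAt (fun s : ℝ => f (z + s • (y - z))) ⟪f', y - z⟫ 0 := by
    simpa [Function.comp_def] using hf0.comp_hasDerivAt (0:ℝ) hline
  have hd2 : HasDerivAt (fun s : ℝ => μ / 2 * (‖z‖ ^ 2 + 2 * s * ⟪z, y - z⟫ + s ^ 2 * ‖y - z‖ ^ 2))
      (μ * ⟪z, y - z⟫) 0 := by
    have := (((((hasDerivAt_id (0:ℝ)).const_mul 2).mul_const ⟪z, y - z⟫).const_add (‖z‖ ^ 2)).add
      (((hasDerivAt_id (0:ℝ)).pow 2).mul_const (‖y - z‖ ^ 2))).const_mul (μ / 2)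
    refine this.congr_deriv ?_
    simp only [id]; ring
  have hs := hk.le_slope_of_hasDerivAt (x := 0) (y := 1) (by simp) (by simp) one_pos (hd1.sub hd2)
  rw [slope_def_field] at hs
  simp only [one_smul, zero_smul, add_zero, add_sub_cancel] at hs
  have := aux_norm_smul z (y - z) 1
  linarith

lemma aux_fen_le {p : ℕ} {h : EV p → ℝ} {u : EV p} (hu : fenchel h u < ⊤) (y : EV p) :
    ⟪y, u⟫ - h y ≤ (fenchel h u).toReal := by
  have h1 : ((⟪y, u⟫ - h y : ℝ) : EReal) ≤ fenchel h u :=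
    le_iSup (fun x => ((⟪x, u⟫ - h x : ℝ) : EReal)) y
  have hb : fenchel h u ≠ ⊥ := fun hb => by
    rw [hb] at h1; exact EReal.coe_ne_bot _ (le_bot_iff.1 h1)
  rw [← EReal.coe_toReal hu.ne hb] at h1
  exact_mod_cast h1

lemma aux_fen_eq {p : ℕ} {h : EV p → ℝ} {u z : EV p}
    (hs : ∀ y, h z + ⟪u, y - z⟫ ≤ h y) : fenchel h u = ((⟪z, u⟫ - h z : ℝ) : EReal) := by
  apply le_antisymm
  · apply iSup_le
    intro y
    have := hs y
    rw [inner_sub_right, real_inner_comm y u, real_inner_comm z u] at this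
    exact_mod_cast (by linarith)
  · exact le_iSup (fun x => ((⟪x, u⟫ - h x : ℝ) : EReal)) z

lemma aux_bound {p : ℕ} {h : EV p → ℝ} {u : EV p} {β : ℝ} (hβ : 0 < β)
    (hlip : ∀ a b, |h a - h b| ≤ β * ‖a - b‖) (hu : fenchel h u < ⊤) : ‖u‖ ≤ β := by
  by_contra hc
  push Not at hc
  have hpos : 0 < ‖u‖ * (‖u‖ - β) := mul_pos (hβ.trans hc) (by linarith)
  obtain ⟨n, hn⟩ := exists_nat_gt (((fenchel h u).toReal + h 0) / (‖u‖ * (‖u‖ - β)))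
  rw [div_lt_iff₀ hpos] at hn
  have h1 := aux_fen_le hu ((n : ℝ) • u)
  have h2 := (le_abs_self _).trans (hlip ((n : ℝ) • u) 0)
  rw [sub_zero, norm_smul, Real.norm_eq_abs, abs_of_nonneg (Nat.cast_nonneg n)] at h2
  rw [inner_smul_left, real_inner_self_eq_norm_sq] at h1
  simp only [conj_trivial] at h1
  nlinarith

lemma aux_conj {p : ℕ} {h : EV p → ℝ} {μ : ℝ} {u z v : EV p}
    (hc : ConvexOn ℝ {v : EV p | fenchel h v < ⊤}
      (fun v => (fenchel h v).toReal - μ / 2 * ‖v‖ ^ 2))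
    (hs : ∀ y, h z + ⟪u, y - z⟫ ≤ h y) (hv : fenchel h v < ⊤) :
    (fenchel h u).toReal + ⟪z, v - u⟫ + μ / 2 * ‖v - u‖ ^ 2 ≤ (fenchel h v).toReal := by
  have he := aux_fen_eq hs
  have hu : fenchel h u < ⊤ := by rw [he]; exact EReal.coe_lt_top _
  have her : (fenchel h u).toReal = ⟪z, u⟫ - h z := by rw [he, EReal.toReal_coe]
  have key : (fenchel h u).toReal + ⟪z, v - u⟫ + μ / 2 * ‖v - u‖ ^ 2 - (fenchel h v).toReal ≤ 0 := by
    apply aux_limit (B := μ / 2 * ‖v - u‖ ^ 2)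
    intro s hs0 hs1
    have hmem := hc.1 hu hv (by linarith : 0 ≤ 1 - s) hs0.le (by ring)
    have h2 := hc.2 hu hv (by linarith : 0 ≤ 1 - s) hs0.le (by ring)
    have e : (1 - s) • u + s • v = u + s • (v - u) := by module
    rw [e] at h2 hmem
    have h3 := aux_fen_le hmem z
    simp only [smul_eq_mul] at h2
    have e3 : ‖v‖ ^ 2 = ‖u‖ ^ 2 + 2 * ⟪u, v - u⟫ + ‖v - u‖ ^ 2 := by
      simpa using aux_norm_smul u (v - u) 1
    rw [aux_norm_smul, e3] at h2
    rw [inner_add_right, inner_smul_right] at h3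
    have : s * ((fenchel h u).toReal + ⟪z, v - u⟫ + μ / 2 * ‖v - u‖ ^ 2 - (fenchel h v).toReal)
        ≤ s * (s * (μ / 2 * ‖v - u‖ ^ 2)) := by
      nlinarith
    exact le_of_mul_le_mul_left this hs0
  linarith

/-- **Key recursive inequality, Variant 2** for the adaptive three operator
splitting iterates (`γ (t-1)` for `t = 0` is `γ 0` by truncated subtraction,
implementing `γ₋₁ = γ₀`; the convention `δ₋₁ = 0` is implemented by the `if`). -/
theorem key_recursive_inequality_variant2 {p : ℕ}
    (f g h : EuclideanSpace ℝ (Fin p) → ℝ)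
    (f' : EuclideanSpace ℝ (Fin p) → EuclideanSpace ℝ (Fin p))
    (L_f μ_f μ_h τ β_h : ℝ)
    (hf : ConvexOn ℝ Set.univ f) (hg : ConvexOn ℝ Set.univ g)
    (hh : ConvexOn ℝ Set.univ h)
    (hf' : ∀ w, HasGradientAt f (f' w) w)
    (hsmooth : ∀ a b, ‖f' a - f' b‖ ≤ L_f * ‖a - b‖)
    (hμf : 0 ≤ μ_f)
    (hfsc : ConvexOn ℝ Set.univ (fun w => f w - μ_f / 2 * ‖w‖ ^ 2))
    (hμh : 0 ≤ μ_h)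
    (hconjsc : ConvexOn ℝ {v : EuclideanSpace ℝ (Fin p) | fenchel h v < ⊤}
      (fun v => (fenchel h v).toReal - μ_h / 2 * ‖v‖ ^ 2))
    (hβ : 0 < β_h) (hlip : ∀ a b, |h a - h b| ≤ β_h * ‖a - b‖)
    (hτ : τ ∈ Set.Ioo (0 : ℝ) 1)
    (γ : ℕ → ℝ) (x z u : ℕ → EuclideanSpace ℝ (Fin p)) (δ : ℕ → ℝ)
    (hu0 : ‖u 0‖ ≤ β_h)
    (hγpos : ∀ t, 0 < γ t)
    (hx : ∀ t, IsProx g (γ t) (z t - γ t • u t - γ t • f' (z t)) (x (t + 1)))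
    (hz : ∀ t, IsProx h (γ t) (x (t + 1) + γ t • u t) (z (t + 1)))
    (hu : ∀ t, u (t + 1) = u t + (γ t)⁻¹ • (x (t + 1) - z (t + 1)))
    (hδ : ∀ t, δ t = f (z t) + ⟪f' (z t), x (t + 1) - z t⟫ +
      ‖x (t + 1) - z t‖ ^ 2 / (2 * γ t) - f (x (t + 1)))
    (hδpos : ∀ t, 0 ≤ δ t)
    (hlb : ∀ t, min (γ 0) (τ / L_f) ≤ γ t)
    (hγμ : ∀ t, γ t * μ_f ≤ 1)
    (hgrow : ∀ t, 1 ≤ t → γ t ≤ γ (t - 1) ∨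
      γ t ^ 2 ≤ γ (t - 1) ^ 2 + γ (t - 1) * δ (t - 1) / (4 * β_h ^ 2)) :
    ∀ (t : ℕ) (xx uu : EuclideanSpace ℝ (Fin p)), fenchel h uu < ⊤ →
      2 * γ t * (saddleL f g h (x (t + 1)) uu - saddleL f g h xx (u (t + 1))) +
          ‖z (t + 1) - xx‖ ^ 2 +
          (1 + μ_f * μ_h) * (γ t) ^ 2 * ‖u (t + 1) - uu‖ ^ 2 ≤
        (1 - μ_f * min (γ 0) (τ / L_f)) * ‖z t - xx‖ ^ 2 +
          (γ (t - 1)) ^ 2 * ‖u t - uu‖ ^ 2 +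
          (if t = 0 then 0 else γ (t - 1) * δ (t - 1)) - 2 * γ t * δ t := by
  intro t xx uu huu
  have hsub : ∀ t y, h (z (t+1)) + ⟪u (t+1), y - z (t+1)⟫ ≤ h y := by
    intro t y
    have h1 := aux_prox_s4 hh (hγpos t) (hz t) y
    have e : x (t+1) + γ t • u t - z (t+1) = γ t • u (t+1) := by
      rw [hu t, smul_add, smul_smul, mul_inv_cancel₀ (hγpos t).ne', one_smul]; abel
    rw [e, inner_smul_left] at h1
    simp only [conj_trivial] at h1
    refine le_of_mul_le_mul_left ?_ (hγpos t)
    linarith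
  have hub : ∀ t, ‖u t‖ ≤ β_h := by
    intro t
    cases t with
    | zero => exact hu0
    | succ t =>
      refine aux_bound hβ hlip ?_
      rw [aux_fen_eq (hsub t)]
      exact EReal.coe_lt_top _
  have huub := aux_bound hβ hlip huu
  have hgs : γ t ^ 2 * ‖u t - uu‖ ^ 2 ≤ γ (t - 1) ^ 2 * ‖u t - uu‖ ^ 2 +
      (if t = 0 then 0 else γ (t - 1) * δ (t - 1)) := by
    by_cases ht : t = 0
    · subst ht; simp
    · rw [if_neg ht]
      have hp : 0 ≤ γ (t - 1) * δ (t - 1) := mul_nonneg (hγpos _).le (hδpos _)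
      have hn : ‖u t - uu‖ ^ 2 ≤ 4 * β_h ^ 2 := by
        have h1 : ‖u t - uu‖ ≤ 2 * β_h := (norm_sub_le _ _).trans (by linarith [hub t])
        nlinarith [norm_nonneg (u t - uu)]
      rcases hgrow t (Nat.one_le_iff_ne_zero.2 ht) with h1 | h1
      · have : γ t ^ 2 ≤ γ (t - 1) ^ 2 := pow_le_pow_left₀ (hγpos t).le h1 2
        nlinarith [mul_le_mul_of_nonneg_right this (sq_nonneg ‖u t - uu‖)]
      · have h2 := mul_le_mul_of_nonneg_right h1 (sq_nonneg ‖u t - uu‖)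
        have h3 : γ (t - 1) * δ (t - 1) / (4 * β_h ^ 2) * ‖u t - uu‖ ^ 2 ≤ γ (t - 1) * δ (t - 1) := by
          rw [div_mul_eq_mul_div, div_le_iff₀ (by positivity)]
          exact mul_le_mul_of_nonneg_left hn hp
        linarith
  have hF := aux_grad (hf' (z t)) hfsc xx
  have hG := aux_prox_s4 hg (hγpos t) (hx t) xx
  have hH := aux_conj hconjsc (hsub t) huu
  have hD := hδ t
  have hzr : z (t+1) = x (t+1) - γ t • (u (t+1) - u t) := by
    rw [hu t, add_sub_cancel_left, smul_smul, mul_inv_cancel₀ (hγpos t).ne', one_smul]; abel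
  have hρ : μ_f * min (γ 0) (τ / L_f) * ‖z t - xx‖ ^ 2 ≤ γ t * μ_f * ‖z t - xx‖ ^ 2 := by
    have := mul_le_mul_of_nonneg_left (hlb t) hμf
    exact mul_le_mul_of_nonneg_right (by linarith) (sq_nonneg _)
  have hμ : μ_f * μ_h * γ t ^ 2 * ‖u (t+1) - uu‖ ^ 2 ≤ γ t * μ_h * ‖u (t+1) - uu‖ ^ 2 := by
    refine mul_le_mul_of_nonneg_right ?_ (sq_nonneg _)
    have := mul_le_mul_of_nonneg_right (hγμ t) (mul_nonneg hμh (hγpos t).le)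
    linarith
  have hD' : 2 * γ t * f (x (t+1)) = 2 * γ t * (f (z t) + ⟪f' (z t), x (t + 1) - z t⟫) +
      ‖x (t + 1) - z t‖ ^ 2 - 2 * γ t * δ t := by
    rw [hD]; have := (hγpos t).ne'; field_simp; ring
  have hF' := mul_le_mul_of_nonneg_left hF (by linarith [hγpos t] : 0 ≤ 2 * γ t)
  have hH' := mul_le_mul_of_nonneg_left hH (by linarith [hγpos t] : 0 ≤ 2 * γ t)
  clear hD hF hH hx hz hu hsub hub hgrow hδ hlb hγμ hδpos
  unfold saddleL
  generalize (fenchel h uu).toReal = A at *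
  generalize (fenchel h (u (t+1))).toReal = B at *
  rw [hzr] at hH' ⊢
  have main : 2 * γ t * (f (x (t+1)) + g (x (t+1)) + ⟪x (t+1), uu⟫ - A -
      (f xx + g xx + ⟪xx, u (t+1)⟫ - B)) + ‖x (t+1) - γ t • (u (t+1) - u t) - xx‖ ^ 2
      + γ t ^ 2 * ‖u (t+1) - uu‖ ^ 2 + γ t * μ_h * ‖u (t+1) - uu‖ ^ 2 ≤
      ‖z t - xx‖ ^ 2 - γ t * μ_f * ‖z t - xx‖ ^ 2 + γ t ^ 2 * ‖u t - uu‖ ^ 2 - 2 * γ t * δ t := by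
    rw [norm_sub_rev xx (z t)] at hF'
    rw [norm_sub_rev uu (u (t+1))] at hH'
    have id1 : ‖x (t+1) - γ t • (u (t+1) - u t) - xx‖ ^ 2 + γ t ^ 2 * ‖u (t+1) - uu‖ ^ 2
        + 2 * γ t * ⟪x (t+1), uu⟫ - 2 * γ t * ⟪xx, u (t+1)⟫
        - 2 * γ t * ⟪x (t+1) - γ t • (u (t+1) - u t), uu - u (t+1)⟫
        + ‖x (t+1) - z t‖ ^ 2
        + 2 * γ t * ⟪f' (z t), x (t+1) - z t⟫ - 2 * γ t * ⟪f' (z t), xx - z t⟫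
        - 2 * ⟪z t - γ t • u t - γ t • f' (z t) - x (t+1), xx - x (t+1)⟫
        = ‖z t - xx‖ ^ 2 + γ t ^ 2 * ‖u t - uu‖ ^ 2 := by
      simp only [← real_inner_self_eq_norm_sq, inner_sub_left, inner_sub_right,
        inner_smul_left, inner_smul_right, conj_trivial]
      rw [real_inner_comm (x (t+1)) xx, real_inner_comm (x (t+1)) (z t), real_inner_comm xx (z t),
        real_inner_comm (x (t+1)) (u (t+1)), real_inner_comm (x (t+1)) (u t),
        real_inner_comm xx (u (t+1)), real_inner_comm xx (u t), real_inner_comm (u (t+1)) (u t),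
        real_inner_comm uu (u (t+1)), real_inner_comm uu (u t)]
      ring
    linarith
  linarith
end

section
/- (Primal suboptimality of the weighted ergodic iterate.) Let f, g, h : ℝ^p → ℝ be convex with f differentiable and L_f-smooth, and suppose h is β_h-Lipschitz for some β_h > 0. Let (γ_t), (x_t), (z_t), (u_t) be adaptive three-operator-splitting iterates with δ_t ≥ 0 for all t ≥ 0, and suppose for each t ≥ 1 either γ_t ≤ γ_{t−1}, or ‖u_0‖ ≤ β_h and γ_t² ≤ γ_{t−1}² + γ_{t−1} δ_{t−1}/(4β_h²). Let x* be any minimizer over ℝ^p of P(x) = f(x) + g(x) + h(x). For t ≥ 0 set S_t = Σ_{i=0}^{t} γ_i and x̄_{t+1} = S_t^{−1} Σ_{i=0}^{t} γ_i x_{i+1}. Then for every t ≥ 0: P(x̄_{t+1}) − P(x*) ≤ (‖z_0 − x*‖² + 2γ_0²(‖u_0‖² + β_h²))/(2 S_t). -/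
open scoped RealInnerProductSpace

/-- Subgradient inequality at a proximal point. -/
lemma IsProx.subgrad {p : ℕ} {φ : EuclideanSpace ℝ (Fin p) → ℝ} {γ : ℝ}
    {x z : EuclideanSpace ℝ (Fin p)} (hφ : ConvexOn ℝ Set.univ φ) (hγ : 0 < γ)
    (h : IsProx φ γ x z) (y : EuclideanSpace ℝ (Fin p)) :
    γ * φ z + ⟪x - z, y - z⟫ ≤ γ * φ y := by
  have key : ∀ s : ℝ, 0 < s → s ≤ 1 →
      0 ≤ (γ * φ y - γ * φ z - ⟪x - z, y - z⟫) + s * (‖y - z‖ ^ 2 / 2) := by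
    intro s hs hs1
    have h1 := h ((1 - s) • z + s • y)
    have h2 := hφ.2 (Set.mem_univ z) (Set.mem_univ y) (by linarith : (0:ℝ) ≤ 1 - s) hs.le
      (by ring)
    have e : x - ((1 - s) • z + s • y) = (x - z) - s • (y - z) := by module
    rw [e, norm_sub_sq_real (x - z) (s • (y - z)), real_inner_smul_right, norm_smul, Real.norm_eq_abs, mul_pow,
      sq_abs] at h1
    simp only [smul_eq_mul] at h2
    have h3 : φ z + ‖x - z‖ ^ 2 / (2 * γ) ≤ ((1 - s) * φ z + s * φ y) +
      (‖x - z‖ ^ 2 - 2 * (s * ⟪x - z, y - z⟫) + s ^ 2 * ‖y - z‖ ^ 2) / (2 * γ) := by linarith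
    have h4 : 0 ≤ s * ((γ * φ y - γ * φ z - ⟪x - z, y - z⟫) + s * (‖y - z‖ ^ 2 / 2)) := by
      have h5 := mul_le_mul_of_nonneg_left h3 hγ.le
      have e1 : γ * (φ z + ‖x - z‖ ^ 2 / (2 * γ)) = γ * φ z + ‖x - z‖ ^ 2 / 2 := by
        field_simp
      have e2 : γ * (((1 - s) * φ z + s * φ y) +
        (‖x - z‖ ^ 2 - 2 * (s * ⟪x - z, y - z⟫) + s ^ 2 * ‖y - z‖ ^ 2) / (2 * γ)) =
        γ * ((1 - s) * φ z + s * φ y) +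
        (‖x - z‖ ^ 2 - 2 * (s * ⟪x - z, y - z⟫) + s ^ 2 * ‖y - z‖ ^ 2) / 2 := by
        field_simp
      rw [e1, e2] at h5
      linarith
    exact nonneg_of_mul_nonneg_right h4 hs
  by_contra hc
  push Not at hc
  set A := γ * φ y - γ * φ z - ⟪x - z, y - z⟫ with hA
  have hA0 : A < 0 := by linarith
  set B := ‖y - z‖ ^ 2 / 2 with hB
  have hB0 : 0 ≤ B := by positivity
  have hp : 0 < B - A := by linarith
  have := key (-A / (2 * (B - A))) (by apply div_pos <;> linarith)
    (by rw [div_le_one (by linarith)]; linarith)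
  have h6 : -A / (2 * (B - A)) * B ≤ -A / 2 := by
    rw [div_mul_eq_mul_div, div_le_div_iff₀ (by linarith) (by norm_num)]
    nlinarith
  linarith

lemma norm_le_of_affine_le {p : ℕ} {h : EuclideanSpace ℝ (Fin p) → ℝ} {β : ℝ} (hβ : 0 < β)
    (hlip : ∀ a b, |h a - h b| ≤ β * ‖a - b‖) {v : EuclideanSpace ℝ (Fin p)} {K : ℝ}
    (hK : ∀ y, K + ⟪v, y⟫ ≤ h y) : ‖v‖ ≤ β := by
  by_contra hc
  push Not at hc
  have hv : 0 < ‖v‖ := hβ.trans hc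
  have hm : 0 < ‖v‖ * (‖v‖ - β) := mul_pos hv (by linarith)
  set s := (|h 0 - K| + 1) / (‖v‖ * (‖v‖ - β)) with hs
  have hs0 : 0 < s := by positivity
  have h1 := hK (s • v)
  have h2 := (abs_le.1 (hlip (s • v) 0)).2
  rw [real_inner_smul_right, real_inner_self_eq_norm_sq] at h1
  rw [sub_zero, norm_smul, Real.norm_eq_abs, abs_of_pos hs0] at h2
  have h3 : s * (‖v‖ * (‖v‖ - β)) = |h 0 - K| + 1 := by
    rw [hs]; field_simp
  have h4 := le_abs_self (h 0 - K)
  nlinarith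

lemma grad_ineq {p : ℕ} {f : EuclideanSpace ℝ (Fin p) → ℝ} (hf : ConvexOn ℝ Set.univ f)
    {z d : EuclideanSpace ℝ (Fin p)} (hd : HasGradientAt f d z)
    (w : EuclideanSpace ℝ (Fin p)) : f z + ⟪d, w - z⟫ ≤ f w := by
  have hc := hf.comp_affineMap (AffineMap.lineMap (k := ℝ) z w)
  have hl : HasDerivAt (fun s : ℝ => AffineMap.lineMap (k := ℝ) z w s) (w - z) 0 :=
    AffineMap.hasDerivAt_lineMap
  have hd' : HasFDerivAt f (InnerProductSpace.toDual ℝ _ d)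
      (AffineMap.lineMap (k := ℝ) z w (0:ℝ)) := by
    simpa using hd.hasFDerivAt
  have h1 := hd'.comp_hasDerivAt (0:ℝ) hl
  have h2 := hc.le_slope_of_hasDerivAt (x := 0) (y := 1) (by simp) (by simp) one_pos h1
  simp [slope] at h2
  linarith

lemma exists_eps_subgrad {p : ℕ} {h : EuclideanSpace ℝ (Fin p) → ℝ}
    (hh : ConvexOn ℝ Set.univ h) (hc : Continuous h) (x : EuclideanSpace ℝ (Fin p)) {ε : ℝ}
    (hε : 0 < ε) : ∃ (v : EuclideanSpace ℝ (Fin p)) (K : ℝ),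
      (∀ y, K + ⟪v, y⟫ ≤ h y) ∧ K + ⟪v, x⟫ = h x - ε := by
  obtain ⟨l, c, h1, h2⟩ := ConvexOn.exists_affine_le_of_lt (𝕜 := ℝ) (Set.mem_univ x)
    (by linarith : h x - ε < h x) isClosed_univ
    (hc.lowerSemicontinuous.lowerSemicontinuousOn _) hh
  refine ⟨(InnerProductSpace.toDual ℝ _).symm l, c, fun y => ?_, ?_⟩
  · have := h1 ⟨y, Set.mem_univ y⟩
    simp at this
    rw [InnerProductSpace.toDual_symm_apply]; linarith
  · simp at h2
    rw [InnerProductSpace.toDual_symm_apply]; linarith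

lemma step_ineq {p : ℕ} {z x' z' u u' f' v w : EuclideanSpace ℝ (Fin p)}
    {γ δ fz fx gx hz' fw gw hw K : ℝ} (hγ : 0 < γ)
    (hu : u' = u + γ⁻¹ • (x' - z'))
    (hδ : δ = fz + ⟪f', x' - z⟫ + ‖x' - z‖ ^ 2 / (2 * γ) - fx)
    (h1 : fz + ⟪f', w - z⟫ ≤ fw)
    (h2 : γ * gx + ⟪z - γ • u - γ • f' - x', w - x'⟫ ≤ γ * gw)
    (h3 : hz' + ⟪u', w - z'⟫ ≤ hw)
    (h4 : K + ⟪v, z'⟫ ≤ hz') :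
    γ * (fx + gx + (K + ⟪v, x'⟫) - (fw + gw + hw)) ≤
      (‖z - w‖ ^ 2 - ‖z' - w‖ ^ 2 + γ ^ 2 * (‖u - v‖ ^ 2 - ‖u' - v‖ ^ 2)) / 2 - γ * δ := by
  have hx : x' = z' + γ • (u' - u) := by
    rw [hu, add_sub_cancel_left, smul_smul, mul_inv_cancel₀ hγ.ne', one_smul]; abel
  have hδ' : γ * δ = γ * fz + γ * ⟪f', x' - z⟫ + ‖x' - z‖ ^ 2 / 2 - γ * fx := by
    rw [hδ]; field_simp
  have h1' := mul_le_mul_of_nonneg_left h1 hγ.le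
  have h3' := mul_le_mul_of_nonneg_left h3 hγ.le
  have h4' := mul_le_mul_of_nonneg_left h4 hγ.le
  clear hu hδ h1 h3 h4
  subst hx
  simp only [← real_inner_self_eq_norm_sq, inner_sub_left, inner_sub_right, inner_add_left,
    inner_add_right, real_inner_smul_left, real_inner_smul_right] at *
  simp only [real_inner_comm u u', real_inner_comm u v, real_inner_comm u' v,
    real_inner_comm u z, real_inner_comm u z', real_inner_comm u w, real_inner_comm u' z,
    real_inner_comm u' z', real_inner_comm u' w, real_inner_comm z z', real_inner_comm z w,
    real_inner_comm z' w, real_inner_comm v z', real_inner_comm v w, real_inner_comm v z,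
    real_inner_comm f' z, real_inner_comm f' z', real_inner_comm f' u, real_inner_comm f' u',
    real_inner_comm f' w] at *
  linarith

/-- **Primal suboptimality of the weighted ergodic iterate** of the adaptive
three operator splitting (`γ (t-1)` for `t = 0` is `γ 0` by truncated
subtraction, implementing the convention `γ₋₁ = γ₀`). -/
theorem primal_suboptimality_ergodic {p : ℕ}
    (f g h : EuclideanSpace ℝ (Fin p) → ℝ)
    (f' : EuclideanSpace ℝ (Fin p) → EuclideanSpace ℝ (Fin p))
    (L_f β_h : ℝ)
    (hf : ConvexOn ℝ Set.univ f) (hg : ConvexOn ℝ Set.univ g)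
    (hh : ConvexOn ℝ Set.univ h)
    (hf' : ∀ w, HasGradientAt f (f' w) w)
    (hsmooth : ∀ a b, ‖f' a - f' b‖ ≤ L_f * ‖a - b‖)
    (hβ : 0 < β_h) (hlip : ∀ a b, |h a - h b| ≤ β_h * ‖a - b‖)
    (γ : ℕ → ℝ) (x z u : ℕ → EuclideanSpace ℝ (Fin p)) (δ : ℕ → ℝ)
    (hγpos : ∀ t, 0 < γ t)
    (hx : ∀ t, IsProx g (γ t) (z t - γ t • u t - γ t • f' (z t)) (x (t + 1)))
    (hz : ∀ t, IsProx h (γ t) (x (t + 1) + γ t • u t) (z (t + 1)))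
    (hu : ∀ t, u (t + 1) = u t + (γ t)⁻¹ • (x (t + 1) - z (t + 1)))
    (hδ : ∀ t, δ t = f (z t) + ⟪f' (z t), x (t + 1) - z t⟫ +
      ‖x (t + 1) - z t‖ ^ 2 / (2 * γ t) - f (x (t + 1)))
    (hδpos : ∀ t, 0 ≤ δ t)
    (hstep : ∀ t, 1 ≤ t → γ t ≤ γ (t - 1) ∨
      (‖u 0‖ ≤ β_h ∧
        γ t ^ 2 ≤ γ (t - 1) ^ 2 + γ (t - 1) * δ (t - 1) / (4 * β_h ^ 2)))
    (xstar : EuclideanSpace ℝ (Fin p))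
    (hxstar : ∀ y, f xstar + g xstar + h xstar ≤ f y + g y + h y) :
    ∀ t : ℕ,
      (f ((∑ i ∈ Finset.range (t + 1), γ i)⁻¹ •
            ∑ i ∈ Finset.range (t + 1), γ i • x (i + 1)) +
        g ((∑ i ∈ Finset.range (t + 1), γ i)⁻¹ •
            ∑ i ∈ Finset.range (t + 1), γ i • x (i + 1)) +
        h ((∑ i ∈ Finset.range (t + 1), γ i)⁻¹ •
            ∑ i ∈ Finset.range (t + 1), γ i • x (i + 1))) -
        (f xstar + g xstar + h xstar) ≤
      (‖z 0 - xstar‖ ^ 2 + 2 * (γ 0) ^ 2 * (‖u 0‖ ^ 2 + β_h ^ 2)) /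
        (2 * ∑ i ∈ Finset.range (t + 1), γ i) := by
  intro t
  have hu_sub : ∀ i y, h (z (i + 1)) + ⟪u (i + 1), y - z (i + 1)⟫ ≤ h y := by
    intro i y
    have h1 := (hz i).subgrad hh (hγpos i) y
    have e : x (i + 1) + γ i • u i - z (i + 1) = γ i • u (i + 1) := by
      rw [hu i, smul_add, smul_smul, mul_inv_cancel₀ (hγpos i).ne', one_smul]; abel
    rw [e, real_inner_smul_left, ← mul_add] at h1
    exact le_of_mul_le_mul_left h1 (hγpos i)
  have hu_norm : ∀ i, ‖u (i + 1)‖ ≤ β_h := by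
    intro i
    refine norm_le_of_affine_le hβ hlip
      (K := h (z (i + 1)) - ⟪u (i + 1), z (i + 1)⟫) fun y => ?_
    have := hu_sub i y
    rw [inner_sub_right] at this
    linarith
  have hcont : Continuous h := by
    refine (LipschitzWith.of_dist_le_mul (K := ⟨β_h, hβ.le⟩) fun a b => ?_).continuous
    rw [Real.dist_eq, dist_eq_norm]
    exact hlip a b
  set S := ∑ i ∈ Finset.range (t + 1), γ i with hS
  have hSpos : 0 < S := Finset.sum_pos (fun i _ => hγpos i) (by simp)
  set xb := S⁻¹ • ∑ i ∈ Finset.range (t + 1), γ i • x (i + 1) with hxb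
  have jensen : ∀ φ : EuclideanSpace ℝ (Fin p) → ℝ, ConvexOn ℝ Set.univ φ →
      S * φ xb ≤ ∑ i ∈ Finset.range (t + 1), γ i * φ (x (i + 1)) := by
    intro φ hφ
    have h1 := hφ.map_sum_le (t := Finset.range (t + 1)) (w := fun i => S⁻¹ * γ i)
      (p := fun i => x (i + 1))
      (fun i _ => mul_nonneg (inv_nonneg.2 hSpos.le) (hγpos i).le)
      (by rw [← Finset.mul_sum, ← hS, inv_mul_cancel₀ hSpos.ne']) (by simp)
    simp only [mul_smul, ← Finset.smul_sum, smul_eq_mul, mul_assoc, ← Finset.mul_sum] at h1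
    rw [← hxb] at h1
    have h2 := mul_le_mul_of_nonneg_left h1 hSpos.le
    rwa [← mul_assoc, mul_inv_cancel₀ hSpos.ne', one_mul] at h2
  refine le_of_forall_pos_le_add fun ε hε => ?_
  obtain ⟨v, K, hK, hKx⟩ := exists_eps_subgrad hh hcont xb hε
  have hv := norm_le_of_affine_le hβ hlip hK
  have hstepi : ∀ i, γ i * (f (x (i + 1)) + g (x (i + 1)) + (K + ⟪v, x (i + 1)⟫) -
      (f xstar + g xstar + h xstar)) ≤
      (‖z i - xstar‖ ^ 2 - ‖z (i + 1) - xstar‖ ^ 2 +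
        γ i ^ 2 * (‖u i - v‖ ^ 2 - ‖u (i + 1) - v‖ ^ 2)) / 2 - γ i * δ i := fun i =>
    step_ineq (hγpos i) (hu i) (hδ i) (grad_ineq hf (hf' _) _)
      ((hx i).subgrad hg (hγpos i) xstar) (hu_sub i xstar) (hK _)
  have huv : ∀ i, ‖u (i + 1) - v‖ ^ 2 ≤ 4 * β_h ^ 2 := by
    intro i
    have h1 := norm_sub_le (u (i + 1)) v
    have h2 := hu_norm i
    have h3 := norm_nonneg (u (i + 1) - v)
    nlinarith
  have hγstep : ∀ i, γ (i + 1) ^ 2 * ‖u (i + 1) - v‖ ^ 2 ≤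
      γ i ^ 2 * ‖u (i + 1) - v‖ ^ 2 + γ i * δ i := by
    intro i
    have hn : 0 ≤ γ i * δ i := mul_nonneg (hγpos i).le (hδpos i)
    have hs := hstep (i + 1) (by omega)
    rw [Nat.add_sub_cancel] at hs
    rcases hs with hs | ⟨-, hs⟩
    · have h1 : γ (i + 1) ^ 2 ≤ γ i ^ 2 := pow_le_pow_left₀ (hγpos _).le hs 2
      have := mul_le_mul_of_nonneg_right h1 (sq_nonneg ‖u (i + 1) - v‖)
      linarith
    · have h1 := mul_le_mul_of_nonneg_right hs (sq_nonneg ‖u (i + 1) - v‖)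
      have h2 : γ i * δ i / (4 * β_h ^ 2) * ‖u (i + 1) - v‖ ^ 2 ≤ γ i * δ i := by
        rw [div_mul_eq_mul_div, div_le_iff₀ (by positivity)]
        exact mul_le_mul_of_nonneg_left (huv i) hn
      linarith
  have hsum : ∀ n, ∑ i ∈ Finset.range (n + 1), γ i * (f (x (i + 1)) + g (x (i + 1)) +
      (K + ⟪v, x (i + 1)⟫) - (f xstar + g xstar + h xstar)) +
      ‖z (n + 1) - xstar‖ ^ 2 / 2 + γ n ^ 2 * ‖u (n + 1) - v‖ ^ 2 / 2 + γ n * δ n ≤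
      (‖z 0 - xstar‖ ^ 2 + γ 0 ^ 2 * ‖u 0 - v‖ ^ 2) / 2 := by
    intro n
    induction n with
    | zero =>
      have := hstepi 0
      simp only [zero_add, Finset.sum_range_one] at this ⊢
      linarith
    | succ n ih =>
      rw [Finset.sum_range_succ]
      have h1 := hstepi (n + 1)
      have h2 := hγstep n
      have hn : 0 ≤ γ n * δ n := mul_nonneg (hγpos n).le (hδpos n)
      linarith
  have h1 := hsum t
  have hn : 0 ≤ γ t * δ t := mul_nonneg (hγpos t).le (hδpos t)
  have h2 : ∑ i ∈ Finset.range (t + 1), γ i * (f (x (i + 1)) + g (x (i + 1)) +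
      (K + ⟪v, x (i + 1)⟫) - (f xstar + g xstar + h xstar)) =
      ∑ i ∈ Finset.range (t + 1), γ i * f (x (i + 1)) +
      ∑ i ∈ Finset.range (t + 1), γ i * g (x (i + 1)) + S * (K + ⟪v, xb⟫) -
      S * (f xstar + g xstar + h xstar) := by
    have e : S * ⟪v, xb⟫ = ∑ i ∈ Finset.range (t + 1), γ i * ⟪v, x (i + 1)⟫ := by
      rw [hxb, real_inner_smul_right, ← mul_assoc, mul_inv_cancel₀ hSpos.ne', one_mul, inner_sum]
      simp only [real_inner_smul_right]
    rw [mul_add, e, hS, Finset.sum_mul, Finset.sum_mul, ← Finset.sum_add_distrib,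
      ← Finset.sum_add_distrib, ← Finset.sum_add_distrib, ← Finset.sum_sub_distrib]
    exact Finset.sum_congr rfl fun i _ => by ring
  have h3 := jensen f hf
  have h4 := jensen g hg
  have h5 : ‖u 0 - v‖ ^ 2 ≤ 2 * (‖u 0‖ ^ 2 + β_h ^ 2) := by
    have a1 := norm_sub_le (u 0) v
    have a2 : ‖u 0 - v‖ ^ 2 ≤ (‖u 0‖ + β_h) ^ 2 :=
      pow_le_pow_left₀ (norm_nonneg _) (by linarith) 2
    nlinarith [sq_nonneg (‖u 0‖ - β_h)]
  have h6 := mul_le_mul_of_nonneg_left h5 (sq_nonneg (γ 0))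
  have h7 : 0 ≤ ‖z (t + 1) - xstar‖ ^ 2 := by positivity
  have h8 : 0 ≤ γ t ^ 2 * ‖u (t + 1) - v‖ ^ 2 := by positivity
  rw [h2, hKx] at h1
  rw [← sub_le_iff_le_add, le_div_iff₀ (by positivity)]
  linarith
end

section
/- (Linear convergence rate, Variant 1.) Let f, g, h : ℝ^p → ℝ be convex, with f differentiable, L_f-smooth and μ_f-strongly convex for some μ_f > 0, and with h differentiable with L_h-Lipschitz gradient for some L_h > 0. Let x* be the unique minimizer over ℝ^p of P(x) = f(x) + g(x) + h(x), and set u* = ∇h(x*). Let τ ∈ (0,1), γ_0 > 0, and let (γ_t), (x_t), (z_t), (u_t) be adaptive three-operator-splitting iterates with δ_t ≥ 0 and min{γ_0, τ/L_f} ≤ γ_t ≤ γ_{t−1} for all t ≥ 0 (γ_{−1} = γ_0). Set ρ = μ_f · min{γ_0, τ/L_f} and σ = 1/(1 + γ_0 L_h). Then for every t ≥ 0: ‖x_{t+1} − x*‖² ≤ (1 − min{ρ, σ})^{t+1} · D_0, where D_0 = 6‖z_0 − x*‖² + (6/(1 − σ)) γ_0² ‖u_0 − u*‖². -/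
open scoped RealInnerProductSpace

/-- First-order optimality for convex plus differentiable. -/
theorem aux_opt {p : ℕ} (φ ψ : (EuclideanSpace ℝ (Fin p)) → ℝ) (v x : EuclideanSpace ℝ (Fin p))
    (hφ : ConvexOn ℝ Set.univ φ) (hψ : HasGradientAt ψ v x)
    (hmin : ∀ y, φ x + ψ x ≤ φ y + ψ y) (y : EuclideanSpace ℝ (Fin p)) :
    φ x - ⟪v, y - x⟫ ≤ φ y := by
  have hd : HasDerivAt (fun s : ℝ => s * (φ y - φ x) + ψ (x + s • (y - x)))
      ((φ y - φ x) + ⟪v, y - x⟫) 0 := by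
    have h1 : HasDerivAt (fun s : ℝ => x + s • (y - x)) (y - x) 0 := by
      simpa using ((hasDerivAt_id (0 : ℝ)).smul_const (y - x)).const_add x
    have h2 : HasFDerivAt ψ (InnerProductSpace.toDual ℝ (EuclideanSpace ℝ (Fin p)) v) (x + (0 : ℝ) • (y - x)) := by
      simpa using hψ.hasFDerivAt
    have h3 := h2.comp_hasDerivAt (0 : ℝ) h1
    have h4 := ((hasDerivAt_id (0 : ℝ)).mul_const (φ y - φ x)).add h3
    have e : (1 : ℝ) * (φ y - φ x) + (InnerProductSpace.toDual ℝ (EuclideanSpace ℝ (Fin p)) v) (y - x) =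
        (φ y - φ x) + ⟪v, y - x⟫ := by simp
    rw [← e]
    exact h4
  have ht := hasDerivWithinAt_iff_tendsto_slope.mp (hd.hasDerivWithinAt (s := Set.Ioi 0))
  have hge : 0 ≤ (φ y - φ x) + ⟪v, y - x⟫ := by
    have hs : (Set.Ioi (0 : ℝ)) \ {0} = Set.Ioi 0 := by simp
    rw [hs] at ht
    refine ge_of_tendsto ht ?_
    have : Set.Ioo (0 : ℝ) 1 ∈ nhdsWithin (0 : ℝ) (Set.Ioi 0) := Ioo_mem_nhdsGT one_pos
    filter_upwards [this] with s hs
    rw [slope_def_field]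
    apply div_nonneg _ (by linarith [hs.1])
    have hc := hφ.2 (Set.mem_univ x) (Set.mem_univ y) (by linarith [hs.2] : 0 ≤ 1 - s) hs.1.le
      (by ring)
    have he : (1 - s) • x + s • y = x + s • (y - x) := by module
    rw [he] at hc
    have hm := hmin (x + s • (y - x))
    simp only [smul_eq_mul] at hc
    simp only [zero_smul, add_zero, zero_mul]
    nlinarith
  linarith

theorem aux_grad_s7 {p : ℕ} (φ : (EuclideanSpace ℝ (Fin p)) → ℝ) (v x : EuclideanSpace ℝ (Fin p))
    (hφ : ConvexOn ℝ Set.univ φ) (hv : HasGradientAt φ v x) (y : EuclideanSpace ℝ (Fin p)) :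
    φ x + ⟪v, y - x⟫ ≤ φ y := by
  have hn : HasGradientAt (fun w => - φ w) (-v) x := by
    rw [hasGradientAt_iff_hasFDerivAt] at hv ⊢
    rw [map_neg]
    exact hv.neg
  have := aux_opt φ (fun w => - φ w) (-v) x hφ hn (by simp) y
  rw [inner_neg_left] at this
  linarith

theorem aux_quad {p : ℕ} (c x : EuclideanSpace ℝ (Fin p)) (k : ℝ) :
    HasGradientAt (fun w => k * ‖c - w‖ ^ 2) ((2 * k) • (x - c)) x := by
  rw [hasGradientAt_iff_hasFDerivAt]
  have h1 : HasFDerivAt (fun w : EuclideanSpace ℝ (Fin p) => c - w) (-(ContinuousLinearMap.id ℝ (EuclideanSpace ℝ (Fin p)))) x :=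
    (hasFDerivAt_id x).const_sub c
  have h2 := (h1.norm_sq).const_mul k
  refine h2.congr_fderiv ?_
  ext w
  simp [inner_sub_left, inner_smul_left]
  ring

theorem aux_coco {p : ℕ} (h : (EuclideanSpace ℝ (Fin p)) → ℝ) (h' : (EuclideanSpace ℝ (Fin p)) → (EuclideanSpace ℝ (Fin p))) (L : ℝ)
    (hh : ConvexOn ℝ Set.univ h) (hh' : ∀ w, HasGradientAt h (h' w) w)
    (hL : 0 < L) (hs : ∀ a b, ‖h' a - h' b‖ ≤ L * ‖a - b‖) (x y : EuclideanSpace ℝ (Fin p)) :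
    h x + ⟪h' x, y - x⟫ + ‖h' y - h' x‖ ^ 2 / (4 * L) ≤ h y := by
  set d := h' y - h' x with hd
  set s : ℝ := 1 / (2 * L) with hsd
  have hspos : 0 < s := by positivity
  set w := y - s • d with hw
  have h1 := aux_grad_s7 h _ x hh (hh' x) w
  have h2 := aux_grad_s7 h _ w hh (hh' w) y
  have e1 : y - w = s • d := by rw [hw]; module
  have e2 : w - x = (y - x) - s • d := by rw [hw]; module
  rw [e1, inner_smul_right] at h2
  rw [e2, inner_sub_right, inner_smul_right] at h1
  have h3 : ⟪h' y, d⟫ - ⟪h' x, d⟫ = ‖d‖ ^ 2 := by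
    rw [← inner_sub_left, ← hd, real_inner_self_eq_norm_sq]
  have h4 : ⟪h' y, d⟫ - ⟪h' w, d⟫ ≤ L * s * ‖d‖ ^ 2 := by
    rw [← inner_sub_left]
    have a1 := real_inner_le_norm (h' y - h' w) d
    have a2 := hs y w
    rw [e1, norm_smul, Real.norm_of_nonneg hspos.le] at a2
    nlinarith [norm_nonneg d]
  have hLs : L * s = 1 / 2 := by rw [hsd]; field_simp
  rw [hLs] at h4
  have h5 : ‖d‖ ^ 2 / (4 * L) = s * (1 / 2 * ‖d‖ ^ 2) := by rw [hsd]; field_simp; norm_num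
  rw [h5]
  nlinarith

/-- Cocoercivity (with half of the optimal constant). -/
theorem aux_coco2 {p : ℕ} (h : (EuclideanSpace ℝ (Fin p)) → ℝ) (h' : (EuclideanSpace ℝ (Fin p)) → (EuclideanSpace ℝ (Fin p))) (L : ℝ)
    (hh : ConvexOn ℝ Set.univ h) (hh' : ∀ w, HasGradientAt h (h' w) w)
    (hL : 0 < L) (hs : ∀ a b, ‖h' a - h' b‖ ≤ L * ‖a - b‖) (x y : EuclideanSpace ℝ (Fin p)) :
    ‖h' y - h' x‖ ^ 2 / (2 * L) ≤ ⟪y - x, h' y - h' x⟫ := by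
  have h1 := aux_coco h h' L hh hh' hL hs x y
  have h2 := aux_coco h h' L hh hh' hL hs y x
  rw [norm_sub_rev (h' x)] at h2
  have e : x - y = -(y - x) := by module
  rw [e, inner_neg_right] at h2
  rw [real_inner_comm, inner_sub_left]
  have : ‖h' y - h' x‖ ^ 2 / (2 * L) = 2 * (‖h' y - h' x‖ ^ 2 / (4 * L)) := by
    field_simp; norm_num
  linarith

theorem aux_strong {p : ℕ} (f : (EuclideanSpace ℝ (Fin p)) → ℝ) (f' : (EuclideanSpace ℝ (Fin p)) → (EuclideanSpace ℝ (Fin p))) (μ : ℝ)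
    (hf' : ∀ w, HasGradientAt f (f' w) w)
    (hfsc : ConvexOn ℝ Set.univ (fun w => f w - μ / 2 * ‖w‖ ^ 2)) (x y : EuclideanSpace ℝ (Fin p)) :
    f x + ⟪f' x, y - x⟫ + μ / 2 * ‖y - x‖ ^ 2 ≤ f y := by
  have hq := aux_quad (0 : EuclideanSpace ℝ (Fin p)) x (μ / 2)
  have hg : HasGradientAt (fun w => f w - μ / 2 * ‖w‖ ^ 2) (f' x - μ • x) x := by
    have := hf' x
    rw [hasGradientAt_iff_hasFDerivAt] at this hq ⊢
    rw [map_sub]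
    have h3 := this.sub hq
    simp only [zero_sub, norm_neg, sub_zero] at h3
    have e : 2 * (μ / 2) = μ := by ring
    rw [e] at h3
    exact h3
  have h1 := aux_grad_s7 _ _ x hfsc hg y
  simp only [inner_sub_left, inner_smul_left, inner_sub_right, real_inner_self_eq_norm_sq] at h1
  rw [norm_sub_sq_real]
  simp only [inner_sub_right]
  simp only [conj_trivial] at h1
  rw [real_inner_comm x y]
  linarith

/-- One step of the recursion, first half. -/
theorem aux_step {p : ℕ} (f g h : (EuclideanSpace ℝ (Fin p)) → ℝ) (f' h' : (EuclideanSpace ℝ (Fin p)) → (EuclideanSpace ℝ (Fin p))) (μ γ : ℝ)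
    (hf : ConvexOn ℝ Set.univ f) (hg : ConvexOn ℝ Set.univ g)
    (hf' : ∀ w, HasGradientAt f (f' w) w)
    (hfsc : ConvexOn ℝ Set.univ (fun w => f w - μ / 2 * ‖w‖ ^ 2))
    (hh' : ∀ w, HasGradientAt h (h' w) w) (hγ : 0 < γ)
    (x z u xs : EuclideanSpace ℝ (Fin p))
    (hx : IsProx g γ (z - γ • u - γ • f' z) x)
    (hδ : 0 ≤ f z + ⟪f' z, x - z⟫ + ‖x - z‖ ^ 2 / (2 * γ) - f x)
    (hxs : ∀ y, f xs + g xs + h xs ≤ f y + g y + h y) :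
    ‖(x - xs) + γ • (u - h' xs)‖ ^ 2 ≤
      (1 - γ * μ) * ‖z - xs‖ ^ 2 + γ ^ 2 * ‖u - h' xs‖ ^ 2 := by
  have h1 := aux_opt (fun w => f w + g w) h _ xs (hf.add hg) (hh' xs) hxs x
  have h2 := aux_strong f f' μ hf' hfsc z xs
  have h3 := aux_opt g _ _ x hg (aux_quad (z - γ • u - γ • f' z) x (1 / (2 * γ)))
    (fun y => by have := hx y; rw [div_eq_inv_mul, div_eq_inv_mul] at this; simpa using this) xs
  have e1 : 2 * (1 / (2 * γ)) = γ⁻¹ := by field_simp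
  rw [e1, inner_smul_left] at h3
  simp only [conj_trivial] at h3 h1
  obtain ⟨a, rfl⟩ : ∃ a, x = xs + a := ⟨x - xs, by module⟩
  obtain ⟨b, rfl⟩ : ∃ b, z = xs + b := ⟨z - xs, by module⟩
  obtain ⟨c, rfl⟩ : ∃ c, u = h' xs + c := ⟨u - h' xs, by module⟩
  have k1 : xs + a - xs = a := by module
  have k2 : xs + b - xs = b := by module
  have k3 : h' xs + c - h' xs = c := by module
  have k4 : xs + a - (xs + b) = a - b := by module
  have k5 : xs - (xs + a) = -a := by module
  have k6 : xs - (xs + b) = -b := by module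
  have k7 : xs + a - (xs + b - γ • (h' xs + c) - γ • f' (xs + b))
    = a - b + γ • (h' xs + c + f' (xs + b)) := by module
  rw [k4] at hδ
  rw [k1] at h1
  rw [k6, norm_neg] at h2
  rw [k5, k7] at h3
  rw [k1, k2, k3, norm_add_sq_real, norm_smul, inner_smul_right, mul_pow, Real.norm_of_nonneg hγ.le]
  simp only [inner_add_left, inner_sub_left, inner_smul_left, inner_neg_right, inner_sub_right,
    conj_trivial, real_inner_self_eq_norm_sq] at h1 h2 h3 hδ
  rw [norm_sub_sq_real] at hδ
  rw [real_inner_comm c a] at *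
  rw [real_inner_comm b a] at *
  generalize f' (xs + b) = F at *
  have m3 : γ⁻¹ * -(‖a‖ ^ 2 - ⟪b, a⟫ + γ * (⟪h' xs, a⟫ + ⟪c, a⟫ + ⟪F, a⟫)) =
    -(γ⁻¹ * (‖a‖ ^ 2 - ⟪b, a⟫)) - (⟪h' xs, a⟫ + ⟪c, a⟫ + ⟪F, a⟫) := by
    field_simp; ring
  have m4 : (‖a‖ ^ 2 - 2 * ⟪b, a⟫ + ‖b‖ ^ 2) / (2 * γ) =
    γ⁻¹ * ((‖a‖ ^ 2 - 2 * ⟪b, a⟫ + ‖b‖ ^ 2) / 2) := by field_simp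
  rw [m4] at hδ
  have key : 0 ≤ γ⁻¹ * ((‖b‖ ^ 2 - ‖a‖ ^ 2) / 2) - ⟪c, a⟫ - μ / 2 * ‖b‖ ^ 2 := by
    have m5 : γ⁻¹ * -(‖a‖ ^ 2 - ⟪b, a⟫ + γ * (⟪h' xs, a⟫ + ⟪c, a⟫ + ⟪F, a⟫)) =
      γ⁻¹ * ⟪b, a⟫ - γ⁻¹ * ‖a‖ ^ 2 - (⟪h' xs, a⟫ + ⟪c, a⟫ + ⟪F, a⟫) := by
      field_simp; ring
    linarith
  have key2 := mul_nonneg (by positivity : 0 ≤ 2 * γ) key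
  have m6 : 2 * γ * (γ⁻¹ * ((‖b‖ ^ 2 - ‖a‖ ^ 2) / 2) - ⟪c, a⟫ - μ / 2 * ‖b‖ ^ 2) =
    (‖b‖ ^ 2 - ‖a‖ ^ 2) - 2 * γ * ⟪c, a⟫ - γ * μ * ‖b‖ ^ 2 := by field_simp
  linarith

theorem aux_proxh {p : ℕ} (h : (EuclideanSpace ℝ (Fin p)) → ℝ) (h' : (EuclideanSpace ℝ (Fin p)) → (EuclideanSpace ℝ (Fin p))) (γ : ℝ) (hγ : 0 < γ)
    (hh' : ∀ w, HasGradientAt h (h' w) w) (c z : EuclideanSpace ℝ (Fin p)) (hz : IsProx h γ c z) :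
    h' z = γ⁻¹ • (c - z) := by
  have hG : HasGradientAt (fun w => h w + 1 / (2 * γ) * ‖c - w‖ ^ 2)
      (h' z + (2 * (1 / (2 * γ))) • (z - c)) z := by
    have h1 := hh' z
    have h2 := aux_quad c z (1 / (2 * γ))
    rw [hasGradientAt_iff_hasFDerivAt] at h1 h2 ⊢
    rw [map_add]
    exact h1.add h2
  have e1 : 2 * (1 / (2 * γ)) = γ⁻¹ := by field_simp
  rw [e1] at hG
  set v := h' z + γ⁻¹ • (z - c) with hv
  have h3 := aux_opt (fun _ => 0) _ v z (convexOn_const 0 convex_univ) hG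
    (fun y => by have := hz y; rw [div_eq_inv_mul, div_eq_inv_mul] at this; simpa using this)
    (z - v)
  have e2 : z - v - z = -v := by module
  rw [e2, inner_neg_right, real_inner_self_eq_norm_sq] at h3
  have h4 : ‖v‖ = 0 := by nlinarith [norm_nonneg v]
  have h5 : v = 0 := norm_eq_zero.mp h4
  have : h' z = v + γ⁻¹ • (c - z) := by rw [hv]; module
  rw [this, h5, zero_add]

/-- **Linear convergence rate, Variant 1**, for the adaptive three operator
splitting with non-increasing step-sizes, under strong convexity of `f` and
smoothness of `h`. Here `ρ = μ_f · min{γ₀, τ/L_f}`, `σ = 1/(1 + γ₀ L_h)`,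
and `D₀ = 6‖z₀ - x*‖² + (6/(1-σ)) γ₀² ‖u₀ - u*‖²` with `u* = ∇h(x*)`. -/
theorem linear_convergence_variant1 {p : ℕ}
    (f g h : EuclideanSpace ℝ (Fin p) → ℝ)
    (f' h' : EuclideanSpace ℝ (Fin p) → EuclideanSpace ℝ (Fin p))
    (L_f μ_f L_h τ : ℝ)
    (hf : ConvexOn ℝ Set.univ f) (hg : ConvexOn ℝ Set.univ g)
    (hh : ConvexOn ℝ Set.univ h)
    (hf' : ∀ w, HasGradientAt f (f' w) w)
    (hsmooth : ∀ a b, ‖f' a - f' b‖ ≤ L_f * ‖a - b‖)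
    (hμf : 0 < μ_f)
    (hfsc : ConvexOn ℝ Set.univ (fun w => f w - μ_f / 2 * ‖w‖ ^ 2))
    (hh' : ∀ w, HasGradientAt h (h' w) w)
    (hLh : 0 < L_h)
    (hhsmooth : ∀ a b, ‖h' a - h' b‖ ≤ L_h * ‖a - b‖)
    (hτ : τ ∈ Set.Ioo (0 : ℝ) 1)
    (γ : ℕ → ℝ) (x z u : ℕ → EuclideanSpace ℝ (Fin p)) (δ : ℕ → ℝ)
    (hγpos : ∀ t, 0 < γ t)
    (hx : ∀ t, IsProx g (γ t) (z t - γ t • u t - γ t • f' (z t)) (x (t + 1)))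
    (hz : ∀ t, IsProx h (γ t) (x (t + 1) + γ t • u t) (z (t + 1)))
    (hu : ∀ t, u (t + 1) = u t + (γ t)⁻¹ • (x (t + 1) - z (t + 1)))
    (hδ : ∀ t, δ t = f (z t) + ⟪f' (z t), x (t + 1) - z t⟫ +
      ‖x (t + 1) - z t‖ ^ 2 / (2 * γ t) - f (x (t + 1)))
    (hδpos : ∀ t, 0 ≤ δ t)
    (hlb : ∀ t, min (γ 0) (τ / L_f) ≤ γ t)
    (hmono : ∀ t, γ (t + 1) ≤ γ t)
    (xstar : EuclideanSpace ℝ (Fin p))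
    (hxstar : ∀ y, f xstar + g xstar + h xstar ≤ f y + g y + h y) :
    ∀ t : ℕ,
      ‖x (t + 1) - xstar‖ ^ 2 ≤
        (1 - min (μ_f * min (γ 0) (τ / L_f)) (1 / (1 + γ 0 * L_h))) ^ (t + 1) *
          (6 * ‖z 0 - xstar‖ ^ 2 +
            6 / (1 - 1 / (1 + γ 0 * L_h)) * ((γ 0) ^ 2 * ‖u 0 - h' xstar‖ ^ 2)) := by
  have hg0 := hγpos 0
  have hγle : ∀ t, γ t ≤ γ 0 := fun t => antitone_nat_of_succ_le hmono (Nat.zero_le t)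
  set m := min (μ_f * min (γ 0) (τ / L_f)) (1 / (1 + γ 0 * L_h)) with hm
  have hP : 0 < γ 0 * L_h := by positivity
  have hσ : 1 / (1 + γ 0 * L_h) < 1 := by rw [div_lt_one (by linarith)]; linarith
  have hσm : m ≤ 1 / (1 + γ 0 * L_h) := min_le_right _ _
  set σ := 1 / (1 + γ 0 * L_h) with hσd
  have hm1 : 0 < 1 - m := by linarith
  have hρm : ∀ t, m ≤ γ t * μ_f := fun t => by
    have : m ≤ μ_f * min (γ 0) (τ / L_f) := min_le_left _ _
    nlinarith [hlb t]
  -- the constant `K = 1 / (1 - σ)`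
  obtain ⟨K, hK⟩ : ∃ K, K = 1 / (1 - σ) := ⟨_, rfl⟩
  have hK1 : K * (1 - σ) = 1 := by rw [hK]; field_simp [(by linarith : 1 - σ ≠ 0)]
  have hKpos : 0 < K := by rw [hK]; exact div_pos one_pos (by linarith)
  have hKe : K = 1 + 1 / (γ 0 * L_h) := by
    rw [hK, hσd]
    have : 1 - 1 / (1 + γ 0 * L_h) = (γ 0 * L_h) / (1 + γ 0 * L_h) := by field_simp; ring
    rw [this]; field_simp; ring
  have hK6 : 6 / (1 - σ) = 6 * K := by rw [hK]; ring
  have hKm : 1 ≤ (1 - m) * K := by nlinarith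
  have hstep : ∀ t, ‖(x (t + 1) - xstar) + γ t • (u t - h' xstar)‖ ^ 2 ≤
      (1 - m) * ‖z t - xstar‖ ^ 2 + γ t ^ 2 * ‖u t - h' xstar‖ ^ 2 := fun t => by
    have h1 := aux_step f g h f' h' μ_f (γ t) hf hg hf' hfsc hh' (hγpos t) _ _ _ xstar (hx t)
      (by rw [← hδ]; exact hδpos t) hxstar
    have := hρm t
    nlinarith [sq_nonneg ‖z t - xstar‖]
  have hW : ∀ t, (1 - m) * ‖z t - xstar‖ ^ 2 + γ t ^ 2 * ‖u t - h' xstar‖ ^ 2 ≤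
      (1 - m) * (‖z t - xstar‖ ^ 2 + K * (γ t ^ 2 * ‖u t - h' xstar‖ ^ 2)) := fun t => by
    have : 0 ≤ γ t ^ 2 * ‖u t - h' xstar‖ ^ 2 := by positivity
    nlinarith
  have hrec : ∀ t, ‖z (t + 1) - xstar‖ ^ 2 +
      K * (γ (t + 1) ^ 2 * ‖u (t + 1) - h' xstar‖ ^ 2) ≤
      (1 - m) * (‖z t - xstar‖ ^ 2 + K * (γ t ^ 2 * ‖u t - h' xstar‖ ^ 2)) := fun t => by
    refine le_trans ?_ ((hstep t).trans (hW t))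
    have hgt := hγpos t
    have hut : u (t + 1) = h' (z (t + 1)) := by
      rw [aux_proxh h h' (γ t) hgt hh' _ _ (hz t), hu t]
      rw [show x (t + 1) + γ t • u t - z (t + 1) = γ t • u t + (x (t + 1) - z (t + 1)) by module,
        smul_add, smul_smul, inv_mul_cancel₀ hgt.ne', one_smul]
    have hxt : (x (t + 1) - xstar) + γ t • (u t - h' xstar) =
        (z (t + 1) - xstar) + γ t • (u (t + 1) - h' xstar) := by
      rw [hu t, smul_sub, smul_sub, smul_add, smul_smul, mul_inv_cancel₀ hgt.ne', one_smul]
      module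
    rw [hxt, norm_add_sq_real, norm_smul, mul_pow, inner_smul_right, Real.norm_of_nonneg hgt.le]
    have hc := aux_coco2 h h' L_h hh hh' hLh hhsmooth xstar (z (t + 1))
    rw [← hut] at hc
    generalize ⟪z (t + 1) - xstar, u (t + 1) - h' xstar⟫ = I at *
    have hB : 0 ≤ ‖u (t + 1) - h' xstar‖ ^ 2 := sq_nonneg _
    generalize ‖u (t + 1) - h' xstar‖ ^ 2 = B at *
    have h1 : K * (γ (t + 1) ^ 2 * B) ≤ K * (γ t ^ 2 * B) := by
      have := hmono t
      have := hγpos (t + 1)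
      gcongr
    have h2 : K * (γ t ^ 2 * B) ≤ γ t ^ 2 * B + 2 * (γ t * (B / (2 * L_h))) := by
      have : 1 / (γ 0 * L_h) * (γ t ^ 2 * B) ≤ 1 / (γ t * L_h) * (γ t ^ 2 * B) := by
        have := hγle t
        gcongr
      have e : 1 / (γ t * L_h) * (γ t ^ 2 * B) = 2 * (γ t * (B / (2 * L_h))) := by
        field_simp
      rw [hKe]; linarith
    nlinarith
  have hV : ∀ t, ‖z t - xstar‖ ^ 2 + K * (γ t ^ 2 * ‖u t - h' xstar‖ ^ 2) ≤
      (1 - m) ^ t * (‖z 0 - xstar‖ ^ 2 + K * (γ 0 ^ 2 * ‖u 0 - h' xstar‖ ^ 2)) := by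
    intro t
    induction t with
    | zero => simp
    | succ k ih =>
      refine (hrec k).trans ?_
      rw [pow_succ (1 - m) k, mul_comm _ (1 - m), mul_assoc]
      exact mul_le_mul_of_nonneg_left ih hm1.le
  intro t
  rw [hK6]
  have hWV : (1 - m) * (‖z t - xstar‖ ^ 2 + K * (γ t ^ 2 * ‖u t - h' xstar‖ ^ 2)) ≤
      (1 - m) ^ (t + 1) * (‖z 0 - xstar‖ ^ 2 + K * (γ 0 ^ 2 * ‖u 0 - h' xstar‖ ^ 2)) := by
    rw [pow_succ (1 - m) t, mul_comm _ (1 - m), mul_assoc]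
    exact mul_le_mul_of_nonneg_left (hV t) hm1.le
  have hA := (hstep t).trans ((hW t).trans hWV)
  have hBb : ‖γ t • (u t - h' xstar)‖ ^ 2 ≤
      (1 - m) ^ (t + 1) * (‖z 0 - xstar‖ ^ 2 + K * (γ 0 ^ 2 * ‖u 0 - h' xstar‖ ^ 2)) := by
    refine le_trans ?_ ((hW t).trans hWV)
    rw [norm_smul, mul_pow, Real.norm_of_nonneg (hγpos t).le]
    have : 0 ≤ (1 - m) * ‖z t - xstar‖ ^ 2 := by positivity
    linarith
  have hn : ‖x (t + 1) - xstar‖ ≤ ‖(x (t + 1) - xstar) + γ t • (u t - h' xstar)‖ +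
      ‖γ t • (u t - h' xstar)‖ := by
    have := norm_sub_le ((x (t + 1) - xstar) + γ t • (u t - h' xstar)) (γ t • (u t - h' xstar))
    rwa [add_sub_cancel_right] at this
  have hfin : ∀ a b c : ℝ, 0 ≤ a → a ≤ b + c → a ^ 2 ≤ 2 * b ^ 2 + 2 * c ^ 2 := by
    intro a b c ha hab
    nlinarith [sq_nonneg (b - c)]
  have h8 := hfin _ _ _ (norm_nonneg _) hn
  have h9 := sq_nonneg ‖γ t • (u t - h' xstar)‖
  linarith
end

section
/- (Linear convergence rate, Variant 2.) Let f, g, h : ℝ^p → ℝ be convex, with f differentiable, L_f-smooth and μ_f-strongly convex for some μ_f > 0, with h differentiable with L_h-Lipschitz gradient for some L_h > 0, and with h β_h-Lipschitz for some β_h > 0 and ‖u_0‖ ≤ β_h. Let x* be the unique minimizer over ℝ^p of P(x) = f(x) + g(x) + h(x), and set u* = ∇h(x*). Let τ ∈ (0,1), γ_0 > 0, and let (γ_t), (x_t), (z_t), (u_t) be adaptive three-operator-splitting iterates with δ_t ≥ 0, γ_t ≥ min{γ_0, τ/L_f}, and γ_t μ_f ≤ 1 for all t ≥ 0, and γ_t²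 ≤ γ_{t−1}² + γ_{t−1} δ_{t−1}/(4β_h²) for every t ≥ 1. Set ρ = μ_f · min{γ_0, τ/L_f} and ξ = μ_f/(μ_f + L_h). Then for every t ≥ 0: ‖x_{t+1} − x*‖² ≤ (1 − min{ρ, ξ, 1/2})^{t+1} · E_0, where E_0 = 6‖z_0 − x*‖² + (6/(1 − ξ)) γ_0² ‖u_0 − u*‖². -/
open scoped RealInnerProductSpace

section helpers
variable {E : Type*} [NormedAddCommGroup E] [InnerProductSpace ℝ E] [CompleteSpace E]

/-- First-order optimality for convex plus differentiable. -/
lemma opt_aux {F G : E → ℝ} (hF : ConvexOn ℝ Set.univ F) {w G' : E}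
    (hG : HasGradientAt G G' w) (hmin : ∀ y, F w + G w ≤ F y + G y) (y : E) :
    F w ≤ F y + ⟪G', y - w⟫ := by
  have hline : HasDerivAt (fun s : ℝ => w + s • (y - w)) (y - w) 0 := by
    simpa using ((hasDerivAt_id (0 : ℝ)).smul_const (y - w)).const_add w
  have hG0 : HasFDerivAt G (InnerProductSpace.toDual ℝ E G') (w + (0 : ℝ) • (y - w)) := by
    simpa using hG.hasFDerivAt
  have h1 : HasDerivAt (fun s : ℝ => G (w + s • (y - w))) ⟪G', y - w⟫ 0 := by
    simpa [Function.comp_def] using hG0.comp_hasDerivAt (0 : ℝ) hline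
  have h3 := (hasDerivAt_iff_tendsto_slope.1 h1).mono_left
    (nhdsWithin_mono (0 : ℝ) (fun s (hs : s ∈ Set.Ioi (0 : ℝ)) => ne_of_gt hs))
  have h4 : F w - F y ≤ ⟪G', y - w⟫ := by
    refine ge_of_tendsto h3 ?_
    filter_upwards [Ioo_mem_nhdsGT (zero_lt_one' ℝ)] with s hs
    have hc := hF.2 (Set.mem_univ w) (Set.mem_univ y) (sub_nonneg.2 hs.2.le) hs.1.le (by ring)
    have e : (1 - s) • w + s • y = w + s • (y - w) := by module
    rw [e] at hc
    simp only [smul_eq_mul] at hc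
    have hm := hmin (w + s • (y - w))
    rw [slope_def_field, zero_smul, add_zero, sub_zero, le_div_iff₀ hs.1]
    nlinarith
  linarith

lemma grad_ineq_s8 {F : E → ℝ} (hF : ConvexOn ℝ Set.univ F) {w F' : E}
    (hG : HasGradientAt F F' w) (y : E) :
    F w + ⟪F', y - w⟫ ≤ F y := by
  have hG' : HasGradientAt (fun v => - F v) (-F') w := by
    rw [hasGradientAt_iff_hasFDerivAt] at hG ⊢
    rw [map_neg]; exact hG.fun_neg
  have := opt_aux hF hG' (by intro y; simp) y
  rw [inner_neg_left] at this
  linarith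

lemma grad_normsq (c : ℝ) (x w : E) :
    HasGradientAt (fun v => c * ‖x - v‖ ^ 2) ((2 * c) • (w - x)) w := by
  rw [hasGradientAt_iff_hasFDerivAt]
  have h1 := ((((hasFDerivAt_id (𝕜 := ℝ) w).const_sub x).norm_sq).const_mul c)
  refine h1.congr_fderiv ?_
  ext v
  simp [inner_sub_left, inner_smul_left]
  ring

lemma grad_add {F G : E → ℝ} {F' G' w : E} (hF : HasGradientAt F F' w)
    (hG : HasGradientAt G G' w) : HasGradientAt (fun v => F v + G v) (F' + G') w := by
  rw [hasGradientAt_iff_hasFDerivAt] at hF hG ⊢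
  rw [map_add]; exact hF.fun_add hG

lemma sc_ineq {F : E → ℝ} {μ : ℝ} (hF : ConvexOn ℝ Set.univ (fun w => F w - μ / 2 * ‖w‖ ^ 2))
    {w F' : E} (hG : HasGradientAt F F' w) (y : E) :
    F w + ⟪F', y - w⟫ + μ / 2 * ‖y - w‖ ^ 2 ≤ F y := by
  have h0 := grad_add hG (grad_normsq (-(μ / 2)) (0 : E) w)
  have h1 : HasGradientAt (fun w => F w - μ / 2 * ‖w‖ ^ 2) (F' - μ • w) w := by
    convert h0 using 1
    · ext v; simp; ring
    · rw [sub_zero]; module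
  have h2 := grad_ineq_s8 hF h1 y
  have e : ‖y‖ ^ 2 = ‖w‖ ^ 2 + 2 * ⟪w, y - w⟫ + ‖y - w‖ ^ 2 := by
    rw [← norm_add_sq_real]; congr 2; abel
  simp only [inner_sub_left _ _ (y - w), real_inner_smul_left] at h2
  rw [e] at h2
  linarith

lemma prox_ineq {F : E → ℝ} (hF : ConvexOn ℝ Set.univ F) {γ : ℝ} (hγ : 0 < γ) {x z : E}
    (hp : ∀ y, F z + ‖x - z‖ ^ 2 / (2 * γ) ≤ F y + ‖x - y‖ ^ 2 / (2 * γ)) (y : E) :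
    γ * F z + ⟪x - z, y - z⟫ ≤ γ * F y := by
  have h := opt_aux hF (grad_normsq (1 / (2 * γ)) x z)
    (by intro y; have := hp y; rw [div_eq_inv_mul, div_eq_inv_mul] at this; simpa using this) y
  rw [real_inner_smul_left, ← neg_sub x z, inner_neg_left] at h
  have e : γ * (2 * (1 / (2 * γ)) * -⟪x - z, y - z⟫) = -⟪x - z, y - z⟫ := by
    field_simp
  have := mul_le_mul_of_nonneg_left h hγ.le
  rw [mul_add, e] at this
  linarith

lemma prox_grad {F : E → ℝ} (hF : ConvexOn ℝ Set.univ F) {γ : ℝ} (hγ : 0 < γ) {x z F' : E}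
    (hG : HasGradientAt F F' z)
    (hp : ∀ y, F z + ‖x - z‖ ^ 2 / (2 * γ) ≤ F y + ‖x - y‖ ^ 2 / (2 * γ)) :
    γ • F' = x - z := by
  have h0 : ConvexOn ℝ Set.univ (fun _ : E => (0 : ℝ)) := convexOn_const 0 convex_univ
  have h := opt_aux h0 (grad_add hG (grad_normsq (1 / (2 * γ)) x z))
    (by intro y; have := hp y; rw [div_eq_inv_mul, div_eq_inv_mul] at this; simpa using this)
    (z - (F' + (2 * (1 / (2 * γ))) • (z - x)))
  have e : z - (F' + (2 * (1 / (2 * γ))) • (z - x)) - z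
    = -(F' + (2 * (1 / (2 * γ))) • (z - x)) := by abel
  rw [e, inner_neg_right, real_inner_self_eq_norm_sq] at h
  have h2 : F' + (2 * (1 / (2 * γ))) • (z - x) = 0 := by
    rw [← norm_eq_zero]; nlinarith [norm_nonneg (F' + (2 * (1 / (2 * γ))) • (z - x))]
  have h3 : F' = (2 * (1 / (2 * γ))) • (x - z) := by
    rw [← sub_eq_zero, ← h2]; module
  rw [h3, smul_smul]
  have : γ * (2 * (1 / (2 * γ))) = 1 := by field_simp
  rw [this, one_smul]

lemma grad_bound {F : E → ℝ} (hF : ConvexOn ℝ Set.univ F) {w F' : E} {β : ℝ} (hβ : 0 < β)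
    (hG : HasGradientAt F F' w) (hl : ∀ a b, |F a - F b| ≤ β * ‖a - b‖) : ‖F'‖ ≤ β := by
  have h1 := grad_ineq_s8 hF hG (w + F')
  have h2 := (le_abs_self _).trans (hl (w + F') w)
  rw [add_sub_cancel_left] at h1 h2
  rw [real_inner_self_eq_norm_sq] at h1
  by_contra! hc
  nlinarith [norm_nonneg F']

lemma coco_half {F : E → ℝ} {F' : E → E} (hF : ConvexOn ℝ Set.univ F) {L : ℝ} (hL : 0 < L)
    (hG : ∀ w, HasGradientAt F (F' w) w) (hs : ∀ a b, ‖F' a - F' b‖ ≤ L * ‖a - b‖) (a b : E) :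
    F b + ⟪F' b, a - b⟫ + ‖F' a - F' b‖ ^ 2 / (4 * L) ≤ F a := by
  obtain ⟨D, hD⟩ : ∃ D, D = F' a - F' b := ⟨_, rfl⟩
  obtain ⟨w, hw⟩ : ∃ w, w = a - (1 / (2 * L)) • D := ⟨_, rfl⟩
  have h1 := grad_ineq_s8 hF (hG b) w
  have h2 := grad_ineq_s8 hF (hG w) a
  have h3 : ⟪F' w - F' a, w - a⟫ ≤ L * ‖w - a‖ ^ 2 := by
    refine (real_inner_le_norm _ _).trans ?_
    nlinarith [hs w a, norm_nonneg (w - a)]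
  have e1 : w - a = -((1 / (2 * L)) • D) := by rw [hw]; abel
  have e2 : w - b = (a - b) - (1 / (2 * L)) • D := by rw [hw]; abel
  have e3 : a - w = (1 / (2 * L)) • D := by rw [hw]; abel
  have n : ‖w - a‖ ^ 2 = (1 / (2 * L)) ^ 2 * ‖D‖ ^ 2 := by
    rw [e1, norm_neg, norm_smul, mul_pow, Real.norm_eq_abs, sq_abs]
  have e4 : ⟪F' a, D⟫ - ⟪F' b, D⟫ = ‖D‖ ^ 2 := by
    rw [← inner_sub_left, ← hD, real_inner_self_eq_norm_sq]
  rw [n, e1, inner_neg_right, inner_sub_left, real_inner_smul_right, real_inner_smul_right] at h3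
  rw [e2, inner_sub_right, real_inner_smul_right] at h1
  rw [e3, real_inner_smul_right] at h2
  rw [← hD]
  have k : L * ((1 / (2 * L)) ^ 2 * ‖D‖ ^ 2) = ‖D‖ ^ 2 / (4 * L) := by field_simp; ring
  have k2 : 1 / (2 * L) * ⟪F' a, D⟫ - 1 / (2 * L) * ⟪F' b, D⟫ = 2 * (‖D‖ ^ 2 / (4 * L)) := by
    rw [← mul_sub, e4]; field_simp; ring
  linarith

lemma coco {F : E → ℝ} {F' : E → E} (hF : ConvexOn ℝ Set.univ F) {L : ℝ} (hL : 0 < L)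
    (hG : ∀ w, HasGradientAt F (F' w) w) (hs : ∀ a b, ‖F' a - F' b‖ ≤ L * ‖a - b‖) (a b : E) :
    ‖F' a - F' b‖ ^ 2 ≤ 2 * L * ⟪a - b, F' a - F' b⟫ := by
  have h1 := coco_half hF hL hG hs a b
  have h2 := coco_half hF hL hG hs b a
  rw [norm_sub_rev, ← neg_sub a b, inner_neg_right] at h2
  have e : ⟪a - b, F' a - F' b⟫ = ⟪F' a, a - b⟫ - ⟪F' b, a - b⟫ := by
    rw [real_inner_comm, inner_sub_left]
  have h3 : 2 * (‖F' a - F' b‖ ^ 2 / (4 * L)) ≤ ⟪a - b, F' a - F' b⟫ := by linarith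
  have e5 : 2 * L * (2 * (‖F' a - F' b‖ ^ 2 / (4 * L))) = ‖F' a - F' b‖ ^ 2 := by
    field_simp; ring
  rw [← e5]
  exact mul_le_mul_of_nonneg_left h3 (by positivity)

/-- One step of the method. -/
lemma step_aux {f g : E → ℝ} {γ μ δ : ℝ} (hγ : 0 < γ) {x z zp u up fz s us : E}
    (hμ : 0 < μ)
    (hf : f z + ⟪fz, s - z⟫ + μ / 2 * ‖s - z‖ ^ 2 ≤ f s)
    (hg : γ * g x + ⟪z - γ • u - γ • fz - x, s - x⟫ ≤ γ * g s)
    (hopt : f s + g s + μ / 2 * ‖x - s‖ ^ 2 ≤ f x + g x + ⟪us, x - s⟫)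
    (hδ : δ = f z + ⟪fz, x - z⟫ + ‖x - z‖ ^ 2 / (2 * γ) - f x)
    (hu : x = zp + γ • (up - u)) :
    ‖zp - s‖ ^ 2 + 2 * γ * ⟪zp - s, up - us⟫ + γ ^ 2 * ‖up - us‖ ^ 2 + 2 * γ * δ
      ≤ (1 - γ * μ) * ‖z - s‖ ^ 2 + γ ^ 2 * ‖u - us‖ ^ 2 := by
  have key : ‖x - s + γ • (u - us)‖ ^ 2 = ‖zp - s + γ • (up - us)‖ ^ 2 := by
    congr 2; rw [hu]; module
  rw [norm_add_sq_real, norm_add_sq_real, real_inner_smul_right, real_inner_smul_right,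
    norm_smul, norm_smul, mul_pow, mul_pow, Real.norm_eq_abs, sq_abs] at key
  have e1 : ⟪z - γ • u - γ • fz - x, s - x⟫ =
      ⟪z - x, s - x⟫ + γ * ⟪u, x - s⟫ + γ * ⟪fz, x - s⟫ := by
    have : z - γ • u - γ • fz - x = (z - x) - γ • u - γ • fz := by abel
    rw [this, inner_sub_left, inner_sub_left, real_inner_smul_left, real_inner_smul_left,
      ← neg_sub x s, inner_neg_right, inner_neg_right, inner_neg_right]
    ring
  have e2 : ‖z - s‖ ^ 2 = ‖z - x‖ ^ 2 - 2 * ⟪z - x, s - x⟫ + ‖x - s‖ ^ 2 := by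
    rw [norm_sub_rev x s, ← norm_sub_sq_real]; congr 2; abel
  have e3 : ⟪fz, x - s⟫ = ⟪fz, x - z⟫ - ⟪fz, s - z⟫ := by
    rw [← inner_sub_right]; congr 1; abel
  have e4 : γ * (‖x - z‖ ^ 2 / (2 * γ)) = ‖z - x‖ ^ 2 / 2 := by
    rw [norm_sub_rev]; field_simp
  have e5 : ⟪x - s, u - us⟫ = ⟪u, x - s⟫ - ⟪us, x - s⟫ := by
    rw [real_inner_comm, inner_sub_left]
  have e6 : γ * δ = γ * f z + γ * ⟪fz, x - z⟫ + ‖z - x‖ ^ 2 / 2 - γ * f x := by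
    rw [← e4, hδ]; ring
  have h1 := mul_le_mul_of_nonneg_left hf hγ.le
  have h2 := mul_le_mul_of_nonneg_left hopt hγ.le
  rw [norm_sub_rev s z] at h1
  rw [e1, e3] at hg
  rw [e5] at key
  have h3 : 0 ≤ γ * (μ * ‖x - s‖ ^ 2) := by positivity
  nlinarith

end helpers

/-- **Linear convergence rate, Variant 2**, for the adaptive three operator
splitting with growing step-sizes, under strong convexity of `f`, smoothness
of `h` and Lipschitz continuity of `h`. Here `ρ = μ_f · min{γ₀, τ/L_f}`,
`ξ = μ_f/(μ_f + L_h)`, and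
`E₀ = 6‖z₀ - x*‖² + (6/(1-ξ)) γ₀² ‖u₀ - u*‖²` with `u* = ∇h(x*)`;
`γ (t-1)` for `t = 0` is `γ 0`, implementing `γ₋₁ = γ₀`. -/
theorem linear_convergence_variant2 {p : ℕ}
    (f g h : EuclideanSpace ℝ (Fin p) → ℝ)
    (f' h' : EuclideanSpace ℝ (Fin p) → EuclideanSpace ℝ (Fin p))
    (L_f μ_f L_h β_h τ : ℝ)
    (hf : ConvexOn ℝ Set.univ f) (hg : ConvexOn ℝ Set.univ g)
    (hh : ConvexOn ℝ Set.univ h)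
    (hf' : ∀ w, HasGradientAt f (f' w) w)
    (hsmooth : ∀ a b, ‖f' a - f' b‖ ≤ L_f * ‖a - b‖)
    (hμf : 0 < μ_f)
    (hfsc : ConvexOn ℝ Set.univ (fun w => f w - μ_f / 2 * ‖w‖ ^ 2))
    (hh' : ∀ w, HasGradientAt h (h' w) w)
    (hLh : 0 < L_h)
    (hhsmooth : ∀ a b, ‖h' a - h' b‖ ≤ L_h * ‖a - b‖)
    (hβ : 0 < β_h) (hlip : ∀ a b, |h a - h b| ≤ β_h * ‖a - b‖)
    (hτ : τ ∈ Set.Ioo (0 : ℝ) 1)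
    (γ : ℕ → ℝ) (x z u : ℕ → EuclideanSpace ℝ (Fin p)) (δ : ℕ → ℝ)
    (hu0 : ‖u 0‖ ≤ β_h)
    (hγpos : ∀ t, 0 < γ t)
    (hx : ∀ t, IsProx g (γ t) (z t - γ t • u t - γ t • f' (z t)) (x (t + 1)))
    (hz : ∀ t, IsProx h (γ t) (x (t + 1) + γ t • u t) (z (t + 1)))
    (hu : ∀ t, u (t + 1) = u t + (γ t)⁻¹ • (x (t + 1) - z (t + 1)))
    (hδ : ∀ t, δ t = f (z t) + ⟪f' (z t), x (t + 1) - z t⟫ +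
      ‖x (t + 1) - z t‖ ^ 2 / (2 * γ t) - f (x (t + 1)))
    (hδpos : ∀ t, 0 ≤ δ t)
    (hlb : ∀ t, min (γ 0) (τ / L_f) ≤ γ t)
    (hγμ : ∀ t, γ t * μ_f ≤ 1)
    (hgrow : ∀ t, 1 ≤ t →
      γ t ^ 2 ≤ γ (t - 1) ^ 2 + γ (t - 1) * δ (t - 1) / (4 * β_h ^ 2))
    (xstar : EuclideanSpace ℝ (Fin p))
    (hxstar : ∀ y, f xstar + g xstar + h xstar ≤ f y + g y + h y) :
    ∀ t : ℕ,
      ‖x (t + 1) - xstar‖ ^ 2 ≤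
        (1 - min (μ_f * min (γ 0) (τ / L_f)) (min (μ_f / (μ_f + L_h)) (1 / 2))) ^
            (t + 1) *
          (6 * ‖z 0 - xstar‖ ^ 2 +
            6 / (1 - μ_f / (μ_f + L_h)) * ((γ 0) ^ 2 * ‖u 0 - h' xstar‖ ^ 2)) := by
  have hustar : ‖h' xstar‖ ≤ β_h := grad_bound hh hβ (hh' xstar) hlip
  have hup : ∀ t, u (t + 1) = h' (z (t + 1)) := by
    intro t
    have h1 := prox_grad hh (hγpos t) (hh' (z (t + 1))) (hz t)
    have h2 : (γ t)⁻¹ • (γ t • h' (z (t + 1))) = h' (z (t + 1)) := by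
      rw [smul_smul, inv_mul_cancel₀ (hγpos t).ne', one_smul]
    rw [← h2, h1, hu t]
    have h3 : (γ t)⁻¹ • (γ t • u t) = u t := by
      rw [smul_smul, inv_mul_cancel₀ (hγpos t).ne', one_smul]
    calc _ = (γ t)⁻¹ • (γ t • u t) + (γ t)⁻¹ • (x (t + 1) - z (t + 1)) := by rw [h3]
      _ = _ := by module
  have hxz : ∀ t, x (t + 1) = z (t + 1) + γ t • (u (t + 1) - u t) := by
    intro t
    rw [hu t, add_sub_cancel_left, smul_smul, mul_inv_cancel₀ (hγpos t).ne', one_smul]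
    abel
  have hopt : ∀ y, f xstar + g xstar + μ_f / 2 * ‖y - xstar‖ ^ 2
      ≤ f y + g y + ⟪h' xstar, y - xstar⟫ := by
    intro y
    have h1 := opt_aux hg (grad_add (hf' xstar) (hh' xstar))
      (by intro y; linarith [hxstar y]) y
    have h2 := sc_ineq hfsc (hf' xstar) y
    rw [inner_add_left] at h1
    linarith
  obtain ⟨θ, hθ⟩ : ∃ θ, θ = min (μ_f * min (γ 0) (τ / L_f))
    (min (μ_f / (μ_f + L_h)) (1 / 2)) := ⟨_, rfl⟩
  rw [← hθ]
  have hθ1 : ∀ t, θ ≤ γ t * μ_f := by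
    intro t
    rw [hθ, mul_comm (γ t)]
    exact (min_le_left _ _).trans (mul_le_mul_of_nonneg_left (hlb t) hμf.le)
  have hθ2 : θ ≤ μ_f / (μ_f + L_h) := by
    rw [hθ]; exact (min_le_right _ _).trans (min_le_left _ _)
  have hθ3 : θ ≤ 1 / 2 := by
    rw [hθ]; exact (min_le_right _ _).trans (min_le_right _ _)
  have hξ : 1 - μ_f / (μ_f + L_h) = L_h / (μ_f + L_h) := by field_simp; ring
  obtain ⟨c, hc⟩ : ∃ c, c = 1 + min (μ_f / L_h) 1 := ⟨_, rfl⟩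
  have hc1 : 1 ≤ c := by
    have : 0 ≤ min (μ_f / L_h) 1 := by positivity
    linarith
  have hc2 : c ≤ 2 := by linarith [min_le_right (μ_f / L_h) 1]
  have hc3 : c ≤ 1 + μ_f / L_h := by linarith [min_le_left (μ_f / L_h) 1]
  have hc4 : 1 ≤ (1 - θ) * c := by
    rcases min_choice (μ_f / L_h) 1 with hm | hm
    · rw [hc, hm]
      have h1 : L_h / (μ_f + L_h) ≤ 1 - θ := by rw [← hξ]; linarith
      have h2 : L_h / (μ_f + L_h) * (1 + μ_f / L_h) = 1 := by field_simp; ring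
      exact h2.symm.le.trans (mul_le_mul_of_nonneg_right h1 (by positivity))
    · rw [hc, hm]; linarith
  obtain ⟨V, hV⟩ : ∃ V : ℕ → ℝ, ∀ t, V t = ‖z t - xstar‖ ^ 2
    + c * (γ t ^ 2 * ‖u t - h' xstar‖ ^ 2) := ⟨_, fun _ => rfl⟩
  have hbase : ∀ t, ‖z (t + 1) - xstar‖ ^ 2 + c * (γ t ^ 2 * ‖u (t + 1) - h' xstar‖ ^ 2)
      + 2 * (γ t * δ t) ≤ (1 - θ) * V t := by
    intro t
    have h1 := step_aux (hγpos t) hμf (sc_ineq hfsc (hf' (z t)) xstar)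
      (prox_ineq hg (hγpos t) (hx t) xstar) (hopt (x (t + 1))) (hδ t) (hxz t)
    have h2 := coco hh hLh hh' hhsmooth (z (t + 1)) xstar
    rw [← hup t] at h2
    have hg0 := hγpos t
    have hB : 0 ≤ ‖u (t + 1) - h' xstar‖ ^ 2 := by positivity
    have h3 : (c - 1) * (γ t ^ 2 * ‖u (t + 1) - h' xstar‖ ^ 2)
        ≤ 2 * γ t * ⟪z (t + 1) - xstar, u (t + 1) - h' xstar⟫ := by
      have a1 : (c - 1) * γ t ≤ 1 / L_h := by
        calc (c - 1) * γ t ≤ (μ_f / L_h) * γ t :=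
              mul_le_mul_of_nonneg_right (by linarith) hg0.le
          _ = (γ t * μ_f) / L_h := by ring
          _ ≤ 1 / L_h := by gcongr; exact hγμ t
      have a2 : ‖u (t + 1) - h' xstar‖ ^ 2 / L_h
          ≤ 2 * ⟪z (t + 1) - xstar, u (t + 1) - h' xstar⟫ := by
        rw [div_le_iff₀ hLh]; linarith
      calc (c - 1) * (γ t ^ 2 * ‖u (t + 1) - h' xstar‖ ^ 2)
          = ((c - 1) * γ t) * (γ t * ‖u (t + 1) - h' xstar‖ ^ 2) := by ring
        _ ≤ (1 / L_h) * (γ t * ‖u (t + 1) - h' xstar‖ ^ 2) :=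
            mul_le_mul_of_nonneg_right a1 (by positivity)
        _ = γ t * (‖u (t + 1) - h' xstar‖ ^ 2 / L_h) := by ring
        _ ≤ γ t * (2 * ⟪z (t + 1) - xstar, u (t + 1) - h' xstar⟫) :=
            mul_le_mul_of_nonneg_left a2 hg0.le
        _ = _ := by ring
    have h4 : (1 - γ t * μ_f) * ‖z t - xstar‖ ^ 2 ≤ (1 - θ) * ‖z t - xstar‖ ^ 2 :=
      mul_le_mul_of_nonneg_right (by linarith [hθ1 t]) (by positivity)
    have h5 : 1 * (γ t ^ 2 * ‖u t - h' xstar‖ ^ 2)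
        ≤ (1 - θ) * c * (γ t ^ 2 * ‖u t - h' xstar‖ ^ 2) :=
      mul_le_mul_of_nonneg_right hc4 (by positivity)
    rw [hV]
    linarith
  have hstep : ∀ t, V (t + 1) ≤ (1 - θ) * V t := by
    intro t
    refine le_trans ?_ (hbase t)
    have h1 := hgrow (t + 1) (by omega)
    rw [Nat.add_sub_cancel] at h1
    have hn : ‖u (t + 1) - h' xstar‖ ≤ 2 * β_h := by
      refine (norm_sub_le _ _).trans ?_
      have : ‖u (t + 1)‖ ≤ β_h := by
        rw [hup t]; exact grad_bound hh hβ (hh' _) hlip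
      linarith
    have hB : ‖u (t + 1) - h' xstar‖ ^ 2 ≤ 4 * β_h ^ 2 := by
      calc ‖u (t + 1) - h' xstar‖ ^ 2 ≤ (2 * β_h) ^ 2 := by gcongr
        _ = _ := by ring
    have hgd : 0 ≤ γ t * δ t := mul_nonneg (hγpos t).le (hδpos t)
    have h2 : γ (t + 1) ^ 2 * ‖u (t + 1) - h' xstar‖ ^ 2
        ≤ γ t ^ 2 * ‖u (t + 1) - h' xstar‖ ^ 2 + γ t * δ t := by
      have a1 := mul_le_mul_of_nonneg_right h1 (sq_nonneg ‖u (t + 1) - h' xstar‖)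
      have a2 : γ t * δ t / (4 * β_h ^ 2) * ‖u (t + 1) - h' xstar‖ ^ 2 ≤ γ t * δ t := by
        rw [div_mul_eq_mul_div, div_le_iff₀ (by positivity)]
        exact mul_le_mul_of_nonneg_left hB hgd
      linarith
    have h3 := mul_le_mul_of_nonneg_left h2 (by linarith : 0 ≤ c)
    have h4 := mul_le_mul_of_nonneg_right hc2 hgd
    rw [hV]
    linarith
  have hθ4 : 0 ≤ 1 - θ := by linarith
  have hpow : ∀ t, V t ≤ (1 - θ) ^ t * V 0 := by
    intro t
    induction t with
    | zero => simp
    | succ k ih =>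
      calc V (k + 1) ≤ (1 - θ) * V k := hstep k
        _ ≤ (1 - θ) * ((1 - θ) ^ k * V 0) := mul_le_mul_of_nonneg_left ih hθ4
        _ = _ := by ring
  have hV0 : 6 * V 0 ≤ 6 * ‖z 0 - xstar‖ ^ 2 +
      6 / (1 - μ_f / (μ_f + L_h)) * ((γ 0) ^ 2 * ‖u 0 - h' xstar‖ ^ 2) := by
    have e : 6 / (1 - μ_f / (μ_f + L_h)) = 6 * (1 + μ_f / L_h) := by
      rw [hξ]; field_simp; ring
    have := mul_le_mul_of_nonneg_right hc3
      (by positivity : 0 ≤ (γ 0) ^ 2 * ‖u 0 - h' xstar‖ ^ 2)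
    rw [e, hV]
    linarith
  intro t
  have hfin : ‖x (t + 1) - xstar‖ ^ 2 ≤ 6 * ((1 - θ) * V t) := by
    have e : x (t + 1) - xstar = (z (t + 1) - xstar) + γ t • (u (t + 1) - h' xstar)
        - γ t • (u t - h' xstar) := by
      rw [hxz t]; module
    have hg0 := hγpos t
    have n1 : ‖x (t + 1) - xstar‖ ≤ ‖z (t + 1) - xstar‖ + γ t * ‖u (t + 1) - h' xstar‖
        + γ t * ‖u t - h' xstar‖ := by
      rw [e]
      refine (norm_sub_le _ _).trans ?_
      have := norm_add_le (z (t + 1) - xstar) (γ t • (u (t + 1) - h' xstar))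
      rw [norm_smul, Real.norm_of_nonneg hg0.le] at this
      rw [norm_smul, Real.norm_of_nonneg hg0.le]
      linarith
    have n2 : ‖x (t + 1) - xstar‖ ^ 2 ≤ 3 * (‖z (t + 1) - xstar‖ ^ 2
        + γ t ^ 2 * ‖u (t + 1) - h' xstar‖ ^ 2 + γ t ^ 2 * ‖u t - h' xstar‖ ^ 2) := by
      have := pow_le_pow_left₀ (norm_nonneg _) n1 2
      nlinarith [sq_nonneg (‖z (t + 1) - xstar‖ - γ t * ‖u (t + 1) - h' xstar‖),
        sq_nonneg (‖z (t + 1) - xstar‖ - γ t * ‖u t - h' xstar‖),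
        sq_nonneg (γ t * ‖u (t + 1) - h' xstar‖ - γ t * ‖u t - h' xstar‖)]
    have n3 := hbase t
    have hgd : 0 ≤ γ t * δ t := mul_nonneg (hγpos t).le (hδpos t)
    have n4 : 1 * (γ t ^ 2 * ‖u (t + 1) - h' xstar‖ ^ 2)
        ≤ c * (γ t ^ 2 * ‖u (t + 1) - h' xstar‖ ^ 2) :=
      mul_le_mul_of_nonneg_right hc1 (by positivity)
    have n5 : 1 * (γ t ^ 2 * ‖u t - h' xstar‖ ^ 2)
        ≤ (1 - θ) * c * (γ t ^ 2 * ‖u t - h' xstar‖ ^ 2) :=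
      mul_le_mul_of_nonneg_right hc4 (by positivity)
    have n6 : 0 ≤ (1 - θ) * ‖z t - xstar‖ ^ 2 := by positivity
    have n7 : (1 - θ) * V t = (1 - θ) * ‖z t - xstar‖ ^ 2
        + (1 - θ) * c * (γ t ^ 2 * ‖u t - h' xstar‖ ^ 2) := by rw [hV]; ring
    linarith
  calc ‖x (t + 1) - xstar‖ ^ 2 ≤ 6 * ((1 - θ) * V t) := hfin
    _ ≤ 6 * ((1 - θ) * ((1 - θ) ^ t * V 0)) := by gcongr; exact hpow t
    _ = (1 - θ) ^ (t + 1) * (6 * V 0) := by ring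
    _ ≤ _ := mul_le_mul_of_nonneg_left hV0 (by positivity)
end

section
/- (Proximal operator of the nearly-isotonic building block.) Let ψ : ℝ² → ℝ be defined by ψ(a, b) = max{a − b, 0}, and let γ > 0. Then for every (a, b) ∈ ℝ², the unique minimizer over (s, t) ∈ ℝ² of γψ(s, t) + ((s − a)² + (t − b)²)/2 equals: (a, b) if a ≤ b; (a − γ, b + γ) if a − b ≥ 2γ; and ((a+b)/2, (a+b)/2) if 0 < a − b < 2γ. -/
/-- **Proximal operator of the nearly-isotonic building block**
`ψ(a, b) = max{a - b, 0}`: for `γ > 0`, the unique minimizer of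
`(s, t) ↦ γ ψ(s, t) + ((s - a)² + (t - b)²)/2` is `(a, b)` if `a ≤ b`,
`(a - γ, b + γ)` if `a - b ≥ 2γ`, and `((a+b)/2, (a+b)/2)` if
`0 < a - b < 2γ`. -/
theorem prox_nearly_isotonic (γ : ℝ) (hγ : 0 < γ) (a b : ℝ)
    (w : ℝ × ℝ)
    (hw : w = if a ≤ b then (a, b)
      else if 2 * γ ≤ a - b then (a - γ, b + γ)
      else ((a + b) / 2, (a + b) / 2)) :
    (∀ q : ℝ × ℝ,
        γ * max (w.1 - w.2) 0 + ((w.1 - a) ^ 2 + (w.2 - b) ^ 2) / 2 ≤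
          γ * max (q.1 - q.2) 0 + ((q.1 - a) ^ 2 + (q.2 - b) ^ 2) / 2) ∧
      (∀ q : ℝ × ℝ,
        γ * max (q.1 - q.2) 0 + ((q.1 - a) ^ 2 + (q.2 - b) ^ 2) / 2 ≤
          γ * max (w.1 - w.2) 0 + ((w.1 - a) ^ 2 + (w.2 - b) ^ 2) / 2 →
        q = w) := by
  obtain ⟨l, hl0, hlg, h1, h2, hm⟩ : ∃ l : ℝ, 0 ≤ l ∧ l ≤ γ ∧ w.1 = a - l ∧ w.2 = b + l ∧
      γ * max (w.1 - w.2) 0 = l * (w.1 - w.2) := by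
    split_ifs at hw with c1 c2
    · refine ⟨0, le_rfl, hγ.le, by simp [hw], by simp [hw], ?_⟩
      rw [hw, max_eq_right (by simpa using c1)]
      ring
    · refine ⟨γ, hγ.le, le_rfl, by simp [hw], by simp [hw], ?_⟩
      rw [hw, max_eq_left (by simp only; linarith)]
    · refine ⟨(a - b) / 2, by linarith, by linarith, by rw [hw]; ring, by rw [hw]; ring, ?_⟩
      simp [hw]
  have key : ∀ q : ℝ × ℝ,
      γ * max (w.1 - w.2) 0 + ((w.1 - a) ^ 2 + (w.2 - b) ^ 2) / 2 +
        ((q.1 - w.1) ^ 2 + (q.2 - w.2) ^ 2) / 2 ≤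
      γ * max (q.1 - q.2) 0 + ((q.1 - a) ^ 2 + (q.2 - b) ^ 2) / 2 := by
    intro q
    have e1 : l * (q.1 - q.2) ≤ l * max (q.1 - q.2) 0 :=
      mul_le_mul_of_nonneg_left (le_max_left _ _) hl0
    have e2 : l * max (q.1 - q.2) 0 ≤ γ * max (q.1 - q.2) 0 :=
      mul_le_mul_of_nonneg_right hlg (le_max_right _ _)
    rw [hm, h1, h2]
    linarith
  refine ⟨fun q => ?_, fun q hq => ?_⟩
  · have := key q
    linarith [sq_nonneg (q.1 - w.1), sq_nonneg (q.2 - w.2)]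
  · have := key q
    have s1 := sq_nonneg (q.1 - w.1)
    have s2 := sq_nonneg (q.2 - w.2)
    have t1 : (q.1 - w.1) ^ 2 = 0 := by linarith
    have t2 : (q.2 - w.2) ^ 2 = 0 := by linarith
    exact Prod.ext (sub_eq_zero.mp (pow_eq_zero_iff two_ne_zero |>.mp t1))
      (sub_eq_zero.mp (pow_eq_zero_iff two_ne_zero |>.mp t2))
end

section
/- (Equivalence with the Davis–Yin three operator splitting recursion at constant step-size.) Let f, g, h : ℝ^p → ℝ be convex with f differentiable, let γ > 0, and let sequences (x_t), (z_t), (u_t) satisfy, for all t ≥ 0: x_{t+1} = prox_{γg}(z_t − γu_t − γ∇f(z_t)), z_{t+1} = prox_{γh}(x_{t+1} + γu_t), u_{t+1} = u_t + (x_{t+1} − z_{t+1})/γ. Define y_t = x_t + γu_{t−1} for t ≥ 1. Then for every t ≥ 1: z_t = prox_{γh}(y_t), x_{t+1} = prox_{γg}(2z_t − y_t − γ∇f(z_t)), and y_{t+1} = y_t − z_t + x_{t+1}. -/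
open scoped RealInnerProductSpace

/-- **Equivalence with the Davis–Yin three operator splitting recursion at
constant step-size.** With `y_t = x_t + γ u_{t-1}` for `t ≥ 1`, the adaptive
algorithm at constant step-size satisfies the standard Davis–Yin recursion:
`z_t = prox_{γh}(y_t)`, `x_{t+1} = prox_{γg}(2 z_t - y_t - γ ∇f(z_t))` and
`y_{t+1} = y_t - z_t + x_{t+1}`. -/
theorem davis_yin_equivalence {p : ℕ}
    (f g h : EuclideanSpace ℝ (Fin p) → ℝ)
    (f' : EuclideanSpace ℝ (Fin p) → EuclideanSpace ℝ (Fin p))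
    (hf : ConvexOn ℝ Set.univ f) (hg : ConvexOn ℝ Set.univ g)
    (hh : ConvexOn ℝ Set.univ h)
    (hf' : ∀ w, HasGradientAt f (f' w) w)
    (γ : ℝ) (hγ : 0 < γ)
    (x z u y : ℕ → EuclideanSpace ℝ (Fin p))
    (hx : ∀ t, IsProx g γ (z t - γ • u t - γ • f' (z t)) (x (t + 1)))
    (hz : ∀ t, IsProx h γ (x (t + 1) + γ • u t) (z (t + 1)))
    (hu : ∀ t, u (t + 1) = u t + γ⁻¹ • (x (t + 1) - z (t + 1)))
    (hy : ∀ t, 1 ≤ t → y t = x t + γ • u (t - 1)) :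
    ∀ t, 1 ≤ t →
      IsProx h γ (y t) (z t) ∧
        IsProx g γ ((2 : ℝ) • z t - y t - γ • f' (z t)) (x (t + 1)) ∧
        y (t + 1) = y t - z t + x (t + 1) := by
  intro t ht
  obtain ⟨s, rfl⟩ : ∃ s, t = s + 1 := ⟨t - 1, by omega⟩
  have hy1 : y (s + 1) = x (s + 1) + γ • u s := by simpa using hy (s + 1) ht
  have hy2 : y (s + 1 + 1) = x (s + 1 + 1) + γ • u (s + 1) := by
    simpa using hy (s + 1 + 1) (by omega)
  have hgu : γ • u (s + 1) = y (s + 1) - z (s + 1) := by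
    rw [hu s, smul_add, smul_smul, mul_inv_cancel₀ hγ.ne', one_smul, hy1]
    abel
  refine ⟨?_, ?_, ?_⟩
  · rw [hy1]
    exact hz s
  · have e : (2 : ℝ) • z (s + 1) - y (s + 1) = z (s + 1) - γ • u (s + 1) := by
      rw [hgu, two_smul]
      abel
    rw [e]
    exact hx (s + 1)
  · rw [hy2, hgu]
    abel
end
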